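/- arXiv:math/9409206 — 4 statements merged into one kernel-verified Lean document; each statement's English description precedes it below -/
import Mathlib

section
/- For every n ≥ 1, there is no universal countable B_n-free graph: there is no countable B_n-free graph G* such that every countable B_n-free graph is isomorphic to a (not necessarily induced) subgraph of G*. -/
open SimpleGraph

/-- `H` is isomorphic to a (not necessarily induced) subgraph of `G`:
    there is an injective graph homomorphism from `H` to `G`. -/
def IsSubgraphOf {V W : Type*} (H : SimpleGraph V) (G : SimpleGraph W) : Prop :=
  ∃ f : H →g G, Function.Injective f

/-- `G` is `F`-free: no subgraph of `G` (not necessarily induced) is isomorphic to `F`. -/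
def GraphFree {V W : Type*} (F : SimpleGraph V) (G : SimpleGraph W) : Prop :=
  ¬ IsSubgraphOf F G

/-- The `n`-bridge `B_n`. Vertices: `0 = a`, `1 = b`, `2 = c`,
    `3,…,n+2 = x₁,…,xₙ`, `n+3 = d`, `n+4 = e`.  Edges: `(a,c)`, `(b,c)`,
    `(c,x₁)`, `(xᵢ,xᵢ₊₁)` for `1 ≤ i < n`, `(xₙ,d)`, `(xₙ,e)`. -/
def Bridge (n : ℕ) : SimpleGraph (Fin (n + 5)) :=
  SimpleGraph.fromRel (fun u v =>
    ((u : ℕ) = 0 ∧ (v : ℕ) = 2) ∨ ((u : ℕ) = 1 ∧ (v : ℕ) = 2) ∨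
    (2 ≤ (u : ℕ) ∧ (u : ℕ) < n + 2 ∧ (v : ℕ) = (u : ℕ) + 1) ∨
    ((u : ℕ) = n + 2 ∧ (v : ℕ) = n + 3) ∨ ((u : ℕ) = n + 2 ∧ (v : ℕ) = n + 4))

theorem isSubgraphOf_bridge {W : Type*} {G : SimpleGraph W} {n : ℕ} (p : ℕ → W) {a b d e : W}
    (hp : ∀ i ≤ n, ∀ k ≤ n, p i = p k → i = k) (hadj : ∀ i < n, G.Adj (p i) (p (i + 1)))
    (ha : G.Adj (p 0) a) (hb : G.Adj (p 0) b) (hd : G.Adj (p n) d) (he : G.Adj (p n) e)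
    (hab : a ≠ b) (had : a ≠ d) (hae : a ≠ e) (hbd : b ≠ d) (hbe : b ≠ e) (hde : d ≠ e)
    (hap : ∀ i ≤ n, p i ≠ a) (hbp : ∀ i ≤ n, p i ≠ b)
    (hdp : ∀ i ≤ n, p i ≠ d) (hep : ∀ i ≤ n, p i ≠ e) :
    IsSubgraphOf (Bridge n) G := by
  let F : ℕ → W := fun k => if k = 0 then a else if k = 1 then b else
    if k ≤ n + 2 then p (k - 2) else if k = n + 3 then d else e
  have F0 : F 0 = a := by simp [F]
  have F1 : F 1 = b := by simp [F]
  have Fp : ∀ i ≤ n, F (i + 2) = p i := by intro i hi; simp [F, hi]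
  have Fd : F (n + 3) = d := by simp [F]
  have Fe : F (n + 4) = e := by simp [F]
  have key : ∀ k < n + 5, k = 0 ∨ k = 1 ∨ (∃ i ≤ n, k = i + 2) ∨ k = n + 3 ∨ k = n + 4 := by
    intro k hk
    by_cases h : 2 ≤ k ∧ k ≤ n + 2
    · exact Or.inr (Or.inr (Or.inl ⟨k - 2, by omega, by omega⟩))
    · omega
  have Finj : ∀ u < n + 5, ∀ v < n + 5, F u = F v → u = v := by
    intro u hu v hv h
    rcases key u hu with rfl | rfl | ⟨i, hi, rfl⟩ | rfl | rfl <;>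
    rcases key v hv with rfl | rfl | ⟨k, hk, rfl⟩ | rfl | rfl <;>
    (try simp only [F0, F1, Fd, Fe] at h) <;>
    (try rw [Fp i hi] at h) <;> (try rw [Fp k hk] at h) <;>
    first
      | rfl
      | exact absurd h (by assumption)
      | exact absurd h.symm (by assumption)
      | exact absurd h (hap _ ‹_›)
      | exact absurd h (hbp _ ‹_›)
      | exact absurd h (hdp _ ‹_›)
      | exact absurd h (hep _ ‹_›)
      | exact absurd h.symm (hap _ ‹_›)
      | exact absurd h.symm (hbp _ ‹_›)
      | exact absurd h.symm (hdp _ ‹_›)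
      | exact absurd h.symm (hep _ ‹_›)
      | exact congrArg (· + 2) (hp i hi k hk h)
  have Fadj : ∀ u v : ℕ, (u = 0 ∧ v = 2) ∨ (u = 1 ∧ v = 2) ∨
      (2 ≤ u ∧ u < n + 2 ∧ v = u + 1) ∨ (u = n + 2 ∧ v = n + 3) ∨ (u = n + 2 ∧ v = n + 4) →
      G.Adj (F u) (F v) := by
    rintro u v (⟨rfl, rfl⟩ | ⟨rfl, rfl⟩ | ⟨h2, hn, rfl⟩ | ⟨rfl, rfl⟩ | ⟨rfl, rfl⟩)
    · rw [F0, show F 2 = p 0 from Fp 0 (by omega)]; exact ha.symm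
    · rw [F1, show F 2 = p 0 from Fp 0 (by omega)]; exact hb.symm
    · obtain ⟨i, rfl⟩ : ∃ i, u = i + 2 := ⟨u - 2, by omega⟩
      rw [Fp i (by omega), show F (i + 2 + 1) = p (i + 1) from Fp (i + 1) (by omega)]
      exact hadj i (by omega)
    · rw [Fd, Fp n le_rfl]; exact hd
    · rw [Fe, Fp n le_rfl]; exact he
  refine ⟨⟨fun k => F k, ?_⟩, ?_⟩
  · rintro u v huv
    rw [Bridge, SimpleGraph.fromRel_adj] at huv
    rcases huv.2 with h | h
    · exact Fadj _ _ h
    · exact (Fadj _ _ h).symm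
  · intro u v h
    exact Fin.ext (Finj u u.2 v v.2 h)

theorem exists_path_of_isSubgraphOf_bridge {W : Type*} {G : SimpleGraph W} {n : ℕ}
    (h : IsSubgraphOf (Bridge n) G) :
    ∃ F : ℕ → W, (∀ u < n + 5, ∀ v < n + 5, F u = F v → u = v) ∧
      G.Adj (F 2) (F 0) ∧ G.Adj (F 2) (F 1) ∧ (∀ i < n, G.Adj (F (i + 2)) (F (i + 3))) ∧
      G.Adj (F (n + 2)) (F (n + 3)) ∧ G.Adj (F (n + 2)) (F (n + 4)) := by
  obtain ⟨f, hf⟩ := h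
  have hadj : ∀ (u v : ℕ) (hu : u < n + 5) (hv : v < n + 5), u ≠ v →
      ((u = 0 ∧ v = 2) ∨ (u = 1 ∧ v = 2) ∨
      (2 ≤ u ∧ u < n + 2 ∧ v = u + 1) ∨ (u = n + 2 ∧ v = n + 3) ∨ (u = n + 2 ∧ v = n + 4)) →
      G.Adj (f ⟨u, hu⟩) (f ⟨v, hv⟩) := by
    intro u v hu hv huv h
    apply f.map_adj
    rw [Bridge, SimpleGraph.fromRel_adj]
    exact ⟨fun h => huv (congrArg Fin.val h), Or.inl h⟩
  have hF : ∀ (u : ℕ) (hu : u < n + 5),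
      (if h : u < n + 5 then f ⟨u, h⟩ else f 0) = f ⟨u, hu⟩ := fun u hu => dif_pos hu
  refine ⟨fun u => if h : u < n + 5 then f ⟨u, h⟩ else f 0, ?_, ?_, ?_, ?_, ?_, ?_⟩
  · intro u hu v hv h
    simp only [hF u hu, hF v hv] at h
    exact congrArg Fin.val (hf h)
  · simp only [hF 0 (by omega), hF 2 (by omega)]
    exact (hadj 0 2 _ _ (by omega) (by omega)).symm
  · simp only [hF 1 (by omega), hF 2 (by omega)]
    exact (hadj 1 2 _ _ (by omega) (by omega)).symm
  · intro i hi
    simp only [hF (i + 2) (by omega), hF (i + 3) (by omega)]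
    exact hadj _ _ _ _ (by omega) (by omega)
  · simp only [hF (n + 2) (by omega), hF (n + 3) (by omega)]
    exact hadj _ _ _ _ (by omega) (by omega)
  · simp only [hF (n + 2) (by omega), hF (n + 4) (by omega)]
    exact hadj _ _ _ _ (by omega) (by omega)

/-- `h` describes a clique on `n + 2` vertices `h j 0`, each carrying a pendant path
`h j 0, h j 1, …, h j (n + 1)`. -/
structure IsHairyClique {W : Type*} (G : SimpleGraph W) (n : ℕ) (h : Fin (n + 2) → ℕ → W) :
    Prop where
  inj : ∀ j k s t, s ≤ n + 1 → t ≤ n + 1 → h j s = h k t → j = k ∧ s = t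
  adj_succ : ∀ j, ∀ t ≤ n, G.Adj (h j t) (h j (t + 1))
  adj_base : ∀ j k, j ≠ k → G.Adj (h j 0) (h k 0)

theorem exists_enum_fin {n : ℕ} (hn : 1 ≤ n) (j : Fin (n + 2)) (P : Fin (n + 2) → Prop)
    (hP : ∀ k l, P k → P l → k = l) :
    ∃ σ : ℕ → Fin (n + 2), (∀ s ≤ n + 1, ∀ t ≤ n + 1, σ s = σ t → s = t) ∧ σ 0 = j ∧
      ¬ P (σ n) := by
  have h0 : ∀ τ : Equiv.Perm (Fin (n + 2)), ∀ s ≤ n + 1, ∀ t ≤ n + 1,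
      τ (Fin.ofNat (n + 2) s) = τ (Fin.ofNat (n + 2) t) → s = t := by
    intro τ s hs t ht h
    have := congrArg Fin.val (τ.injective h)
    simpa [Fin.ofNat, Nat.mod_eq_of_lt (show s < n + 2 by omega),
      Nat.mod_eq_of_lt (show t < n + 2 by omega)] using this
  let τ : Equiv.Perm (Fin (n + 2)) := Equiv.swap 0 j
  by_cases hτ : P (τ (Fin.ofNat (n + 2) n))
  · refine ⟨fun i => (Equiv.swap (Fin.ofNat (n + 2) n) (Fin.ofNat (n + 2) (n + 1))).trans τ
      (Fin.ofNat (n + 2) i), h0 _, ?_, ?_⟩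
    · have hne : ∀ m, 1 ≤ m → m ≤ n + 1 → (Fin.ofNat (n + 2) 0) ≠ Fin.ofNat (n + 2) m := by
        intro m h1 h2 h
        have := h0 1 0 (by omega) m h2 h
        omega
      simp only [Equiv.trans_apply]
      rw [Equiv.swap_apply_of_ne_of_ne (hne n hn (by omega)) (hne (n + 1) (by omega) le_rfl)]
      exact Equiv.swap_apply_left 0 j
    · simp only [Equiv.trans_apply, Equiv.swap_apply_left]
      intro h
      have := h0 τ _ (by omega) _ (by omega) (hP _ _ hτ h)
      omega
  · exact ⟨fun i => τ (Fin.ofNat (n + 2) i), h0 τ, Equiv.swap_apply_left 0 j, hτ⟩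

namespace IsHairyClique

variable {W : Type*} {G : SimpleGraph W} {n : ℕ} {h : Fin (n + 2) → ℕ → W}

theorem base_saturated (hn : 1 ≤ n) (hh : IsHairyClique G n h) (hG : GraphFree (Bridge n) G)
    {j : Fin (n + 2)} {w : W} (hw : G.Adj (h j 0) w) : (∃ k, w = h k 0) ∨ w = h j 1 := by
  by_contra! hcon
  obtain ⟨hc, h1⟩ := hcon
  obtain ⟨σ, hσ, rfl, hσn⟩ := exists_enum_fin hn j (fun k => w = h k 1) (by
    intro k l hk hl
    exact (hh.inj k l 1 1 (by omega) (by omega) (hk.symm.trans hl)).1)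
  apply hG
  have hne : ∀ s ≤ n + 1, ∀ t ≤ n + 1, ∀ a ≤ n + 1, ∀ b ≤ n + 1, (s ≠ t ∨ a ≠ b) →
      h (σ s) a ≠ h (σ t) b := by
    intro s hs t ht a ha b hb hor heq
    obtain ⟨e1, e2⟩ := hh.inj _ _ _ _ ha hb heq
    have := hσ s hs t ht e1
    omega
  refine isSubgraphOf_bridge (fun i => h (σ i) 0) (a := w) (b := h (σ 0) 1) (d := h (σ n) 1)
    (e := h (σ (n + 1)) 0) ?_ ?_ hw (hh.adj_succ _ 0 (by omega)) (hh.adj_succ _ 0 (by omega))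
    ?_ h1 hσn (hc _) ?_ ?_ ?_ ?_ ?_ ?_ ?_
  · intro i hi k hk e
    exact hσ i (by omega) k (by omega) (hh.inj _ _ _ _ (by omega) (by omega) e).1
  · intro i hi
    exact hh.adj_base _ _ fun e => by have := hσ _ (by omega) _ (by omega) e; omega
  · exact hh.adj_base _ _ fun e => by have := hσ _ (by omega) _ (by omega) e; omega
  · exact hne _ (by omega) _ (by omega) _ (by omega) _ (by omega) (by omega)
  · exact hne _ (by omega) _ (by omega) _ (by omega) _ (by omega) (by omega)
  · exact hne _ (by omega) _ (by omega) _ (by omega) _ (by omega) (by omega)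
  · exact fun i _ => (hc _).symm
  all_goals
    intro i hi
    exact hne _ (by omega) _ (by omega) _ (by omega) _ (by omega) (by omega)

theorem eq_of_adj_hair (hn : 1 ≤ n) (hh : IsHairyClique G n h) (hG : GraphFree (Bridge n) G)
    {j : Fin (n + 2)} {t : ℕ} (ht : 1 ≤ t) (htn : t ≤ n) {w : W} (hw : G.Adj (h j t) w)
    (hc : ∀ k, w ≠ h k 0) (hs : ∀ s < t, w ≠ h j s) : w = h j (t + 1) := by
  by_contra h1
  obtain ⟨σ, hσ, rfl, -⟩ := exists_enum_fin hn j (fun k => False) (by simp)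
  apply hG
  have hne : ∀ s ≤ n + 1, ∀ t ≤ n + 1, ∀ a ≤ n + 1, ∀ b ≤ n + 1, (s ≠ t ∨ a ≠ b) →
      h (σ s) a ≠ h (σ t) b := by
    intro s hs t ht a ha b hb hor heq
    obtain ⟨e1, e2⟩ := hh.inj _ _ _ _ ha hb heq
    have := hσ s hs t ht e1
    omega
  have hadj : ∀ s ≤ n + 1, ∀ t ≤ n + 1, s ≠ t → G.Adj (h (σ s) 0) (h (σ t) 0) := by
    intro s hs t ht hst
    exact hh.adj_base _ _ fun e => hst (hσ _ hs _ ht e)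
  have hpn : h (σ (n - t)) (t - n) = h (σ (n - t)) 0 := by rw [show t - n = 0 by omega]
  refine isSubgraphOf_bridge (fun i => h (σ (i - t)) (t - i)) (a := w) (b := h (σ 0) (t + 1))
    (d := h (σ (n - t + 1)) 0) (e := h (σ (n - t + 2)) 0)
    ?_ ?_ ?_ ?_ ?_ ?_ h1 (hc _) (hc _) ?_ ?_ ?_ ?_ ?_ ?_ ?_
  · intro i hi k hk e
    by_contra hik
    exact hne _ (by omega) _ (by omega) _ (by omega) _ (by omega) (by omega) e
  · intro i hi
    by_cases hit : i < t
    · have := (hh.adj_succ (σ 0) (t - (i + 1)) (by omega)).symm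
      simpa only [show i - t = 0 by omega, show i + 1 - t = 0 by omega,
        show t - (i + 1) + 1 = t - i by omega] using this
    · simp only [show t - i = 0 by omega, show t - (i + 1) = 0 by omega]
      exact hadj _ (by omega) _ (by omega) (by omega)
  · simpa using hw
  · simpa using hh.adj_succ (σ 0) t htn
  · simp only [hpn]
    exact hadj _ (by omega) _ (by omega) (by omega)
  · simp only [hpn]
    exact hadj _ (by omega) _ (by omega) (by omega)
  · exact hne _ (by omega) _ (by omega) _ (by omega) _ (by omega) (by omega)
  · exact hne _ (by omega) _ (by omega) _ (by omega) _ (by omega) (by omega)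
  · exact hne _ (by omega) _ (by omega) _ (by omega) _ (by omega) (by omega)
  · intro i hi e
    rcases Nat.lt_or_ge i t with hit | hit
    · simp only [show i - t = 0 by omega] at e
      rcases Nat.eq_zero_or_pos i with rfl | hi0
      · exact hw.ne (by simpa using e)
      · exact hs _ (by omega) e.symm
    · simp only [show t - i = 0 by omega] at e
      exact hc _ e.symm
  all_goals
    intro i hi
    exact hne _ (by omega) _ (by omega) _ (by omega) _ (by omega) (by omega)

theorem saturated (hn : 1 ≤ n) (hh : IsHairyClique G n h) (hG : GraphFree (Bridge n) G)
    {j : Fin (n + 2)} {t : ℕ} (htn : t ≤ n) {w : W} (hw : G.Adj (h j t) w) :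
    (t = 0 ∧ ∃ k ≠ j, w = h k 0) ∨ w = h j (t + 1) ∨ (1 ≤ t ∧ w = h j (t - 1)) := by
  rcases Nat.eq_zero_or_pos t with rfl | ht
  · rcases hh.base_saturated hn hG hw with ⟨k, rfl⟩ | h1
    · exact Or.inl ⟨rfl, k, fun e => hw.ne (by rw [e]), rfl⟩
    · exact Or.inr (Or.inl h1)
  by_cases hc : ∃ k, w = h k 0
  · obtain ⟨k, rfl⟩ := hc
    rcases hh.base_saturated hn hG hw.symm with ⟨l, hl⟩ | hl
    · have := (hh.inj _ _ _ _ (by omega) (by omega) hl).2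
      omega
    · obtain ⟨rfl, rfl⟩ := hh.inj _ _ _ _ (by omega) (by omega) hl
      exact Or.inr (Or.inr ⟨le_rfl, rfl⟩)
  push Not at hc
  by_cases hs : ∃ s < t, w = h j s
  · obtain ⟨s, hst, rfl⟩ := hs
    have hs0 : 1 ≤ s := by
      rcases Nat.eq_zero_or_pos s with rfl | h0
      · exact absurd rfl (hc j)
      · exact h0
    have := hh.eq_of_adj_hair hn hG hs0 (by omega) hw.symm
      (fun k e => by have := (hh.inj _ _ _ _ (by omega) (by omega) e).2; omega)
      (fun r hr e => by have := (hh.inj _ _ _ _ (by omega) (by omega) e).2; omega)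
    have := (hh.inj _ _ _ _ (by omega) (by omega) this).2
    exact Or.inr (Or.inr ⟨ht, by rw [this]; simp⟩)
  · push Not at hs
    exact Or.inr (Or.inl (hh.eq_of_adj_hair hn hG ht htn hw hc hs))

theorem map {V : Type*} {H : SimpleGraph V} {h : Fin (n + 2) → ℕ → V} (hh : IsHairyClique H n h)
    (f : H →g G) (hf : Function.Injective f) : IsHairyClique G n (fun j t => f (h j t)) where
  inj j k s t hs ht e := hh.inj j k s t hs ht (hf e)
  adj_succ j t ht := f.map_adj (hh.adj_succ j t ht)
  adj_base j k hjk := f.map_adj (hh.adj_base j k hjk)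

end IsHairyClique

/-- A two-colouring `M` of `ℤ` whose maximal constant runs have between `n + 2` and `2 n + 2`
elements. -/
structure IsRunPattern (n : ℕ) (M : ℤ → Bool) : Prop where
  right : ∀ b, M b ≠ M (b + 1) → ∀ i, b + 1 ≤ i → i ≤ b + n + 2 → M i = M (b + 1)
  left : ∀ b, M b ≠ M (b + 1) → ∀ i, b - n - 1 ≤ i → i ≤ b → M i = M b
  near : ∀ r : ℤ, ∃ b, M b ≠ M (b + 1) ∧ b - n ≤ r ∧ r ≤ b + n + 1

/-- The vertex `v = (r, j)` is used: on levels `r` with `M r = false` only strand `0` is present,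
on the other levels all strands except `0` are. -/
def OnStrand {n : ℕ} (M : ℤ → Bool) (v : ℤ × Fin (n + 2)) : Prop :=
  v.2 = 0 ↔ M v.1 = false

/-- The chain of `(n + 2)`-cliques with one clique for each colour change of `M`; consecutive
cliques are joined alternately by `n + 1` disjoint paths and by a single path. Unused pairs are
isolated vertices. -/
def strandGraph (n : ℕ) (M : ℤ → Bool) : SimpleGraph (ℤ × Fin (n + 2)) where
  Adj u v := OnStrand M u ∧ OnStrand M v ∧
    ((u.2 = v.2 ∧ (v.1 = u.1 + 1 ∨ u.1 = v.1 + 1)) ∨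
      (u.2 ≠ v.2 ∧ ∃ b, M b ≠ M (b + 1) ∧ (u.1 = b ∨ u.1 = b + 1) ∧ (v.1 = b ∨ v.1 = b + 1)))
  symm := ⟨by
    rintro u v ⟨hu, hv, ⟨h1, h2⟩ | ⟨h1, b, hb, h2, h3⟩⟩
    · exact ⟨hv, hu, Or.inl ⟨h1.symm, h2.symm⟩⟩
    · exact ⟨hv, hu, Or.inr ⟨h1.symm, b, hb, h3, h2⟩⟩⟩
  loopless := ⟨by
    rintro u ⟨-, -, ⟨-, h⟩ | ⟨h, -⟩⟩
    · omega
    · exact h rfl⟩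

theorem OnStrand.eq_of_snd_eq {n : ℕ} {M : ℤ → Bool} {b : ℤ} (hb : M b ≠ M (b + 1))
    {u v : ℤ × Fin (n + 2)} (hu : OnStrand M u) (hv : OnStrand M v)
    (hub : u.1 = b ∨ u.1 = b + 1) (hvb : v.1 = b ∨ v.1 = b + 1) (h : u.2 = v.2) : u = v := by
  have key : M u.1 = M v.1 := by
    unfold OnStrand at hu hv
    rw [← h] at hv
    have := hu.symm.trans hv
    cases h1 : M u.1 <;> cases h2 : M v.1 <;> simp_all
  refine Prod.ext ?_ h
  rcases hub with e | e <;> rcases hvb with e' | e' <;> rw [e, e'] at key ⊢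
  · exact absurd key hb
  · exact absurd key.symm hb

theorem strandGraph_adj_fst {n : ℕ} {M : ℤ → Bool} {u v : ℤ × Fin (n + 2)}
    (h : (strandGraph n M).Adj u v) : u.1 ≤ v.1 + 1 ∧ v.1 ≤ u.1 + 1 := by
  obtain ⟨-, -, ⟨-, h⟩ | ⟨-, b, -, h1, h2⟩⟩ := h <;> omega

theorem strandGraph_adj_cases {n : ℕ} {M : ℤ → Bool} {u v : ℤ × Fin (n + 2)}
    (h : (strandGraph n M).Adj u v) : v = (u.1 + 1, u.2) ∨ v = (u.1 - 1, u.2) ∨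
      ∃ b, M b ≠ M (b + 1) ∧ (u.1 = b ∨ u.1 = b + 1) ∧ (v.1 = b ∨ v.1 = b + 1) := by
  obtain ⟨-, -, ⟨h, h' | h'⟩ | ⟨-, h⟩⟩ := h
  · exact Or.inl (Prod.ext h' h.symm)
  · exact Or.inr (Or.inl (Prod.ext (by simp only; omega) h.symm))
  · exact Or.inr (Or.inr h)

theorem exists_strandGraph_adj {n : ℕ} {M : ℤ → Bool} {v : ℤ × Fin (n + 2)} (hv : OnStrand M v)
    {s : ℤ} (hs : s = v.1 + 1 ∨ v.1 = s + 1) : ∃ u, u.1 = s ∧ (strandGraph n M).Adj u v := by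
  by_cases h : M s = M v.1
  · refine ⟨(s, v.2), rfl, ?_, hv, Or.inl ⟨rfl, ?_⟩⟩
    · simpa [OnStrand, h] using hv
    · simp only
      omega
  · obtain ⟨j, hj⟩ : ∃ j : Fin (n + 2), OnStrand M (s, j) := by
      cases h' : M s
      · exact ⟨0, by simp [OnStrand, h']⟩
      · exact ⟨1, by simp [OnStrand, h']⟩
    refine ⟨(s, j), rfl, hj, hv, Or.inr ⟨?_, ?_⟩⟩
    · intro e
      simp only at e
      unfold OnStrand at hj hv
      simp only [e] at hj
      have := hj.symm.trans hv
      apply h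
      cases h1 : M s <;> cases h2 : M v.1 <;> simp_all
    · rcases hs with rfl | hs
      · exact ⟨v.1, fun e => h e.symm, by simp, by simp⟩
      · exact ⟨s, by rwa [← hs], by simp, by simp [hs]⟩

/-- The path that leaves the clique at the colour change `b` along strand `j`. -/
noncomputable def hair {n : ℕ} (M : ℤ → Bool) (b : ℤ) (j : Fin (n + 2)) (t : ℕ) : ℤ × Fin (n + 2) :=
  open Classical in if OnStrand M (b, j) then (b - t, j) else (b + 1 + t, j)

namespace IsRunPattern

variable {n : ℕ} {M : ℤ → Bool}

theorem eq_of_near (hM : IsRunPattern n M) {b b' : ℤ} (hb : M b ≠ M (b + 1))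
    (hb' : M b' ≠ M (b' + 1)) (h1 : b' ≤ b + n + 1) (h2 : b ≤ b' + n + 1) : b = b' := by
  by_contra hne
  rcases lt_or_gt_of_ne hne with h | h
  · exact hb' ((hM.right b hb b' (by omega) (by omega)).trans
      (hM.right b hb (b' + 1) (by omega) (by omega)).symm)
  · exact hb ((hM.right b' hb' b (by omega) (by omega)).trans
      (hM.right b' hb' (b + 1) (by omega) (by omega)).symm)

theorem onStrand_hair (hM : IsRunPattern n M) {b : ℤ} (hb : M b ≠ M (b + 1)) (j : Fin (n + 2))
    {t : ℕ} (ht : t ≤ n + 1) : OnStrand M (hair M b j t) := by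
  unfold hair
  split_ifs with h
  · have := hM.left b hb (b - t) (by omega) (by omega)
    simpa [OnStrand, this] using h
  · have := hM.right b hb (b + 1 + t) (by omega) (by omega)
    simp only [OnStrand, this] at h ⊢
    cases h1 : M b <;> cases h2 : M (b + 1) <;> simp_all

theorem isHairyClique (hM : IsRunPattern n M) {b : ℤ} (hb : M b ≠ M (b + 1)) :
    IsHairyClique (strandGraph n M) n (hair M b) where
  inj j k s t hs ht h := by
    unfold hair at h
    split_ifs at h <;> simp only [Prod.mk.injEq] at h <;> obtain ⟨h1, rfl⟩ := h <;>
      first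
        | contradiction
        | exact ⟨rfl, by omega⟩
  adj_succ j t ht := by
    refine ⟨hM.onStrand_hair hb j (by omega), hM.onStrand_hair hb j (by omega), Or.inl ?_⟩
    unfold hair
    split_ifs
    · exact ⟨rfl, Or.inr (by push_cast; ring)⟩
    · exact ⟨rfl, Or.inl (by push_cast; ring)⟩
  adj_base j k hjk := by
    refine ⟨hM.onStrand_hair hb j (by omega), hM.onStrand_hair hb k (by omega),
      Or.inr ⟨?_, b, hb, ?_, ?_⟩⟩ <;> unfold hair <;> split_ifs <;> simp [hjk]

theorem exists_hair (hM : IsRunPattern n M) {v : ℤ × Fin (n + 2)} (hv : OnStrand M v) :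
    ∃ b, M b ≠ M (b + 1) ∧ ∃ j, ∃ t ≤ n, v = hair M b j t := by
  obtain ⟨b, hb, h1, h2⟩ := hM.near v.1
  refine ⟨b, hb, v.2, ?_⟩
  by_cases h : v.1 ≤ b
  · have := hM.left b hb v.1 (by omega) h
    refine ⟨(b - v.1).toNat, by omega, ?_⟩
    have hv' : OnStrand M (b, v.2) := by simpa [OnStrand, this] using hv
    rw [hair, if_pos hv']
    exact Prod.ext (by simp only; omega) rfl
  · have := hM.right b hb v.1 (by omega) (by omega)
    refine ⟨(v.1 - b - 1).toNat, by omega, ?_⟩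
    have hv' : ¬ OnStrand M (b, v.2) := by
      simp only [OnStrand, this] at hv ⊢
      cases h1 : M b <;> cases h2 : M (b + 1) <;> simp_all
    rw [hair, if_neg hv']
    exact Prod.ext (by simp only; omega) rfl

/-- In a bridge-free graph a copy of the strand graph has no further edges at used vertices. -/
theorem exists_adj_of_adj_map (hn : 1 ≤ n) (hM : IsRunPattern n M) {W : Type*}
    {G : SimpleGraph W} (hG : GraphFree (Bridge n) G) (f : strandGraph n M →g G)
    (hf : Function.Injective f) {v : ℤ × Fin (n + 2)} (hv : OnStrand M v) {w : W}
    (hw : G.Adj (f v) w) : ∃ u, (strandGraph n M).Adj v u ∧ w = f u := by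
  obtain ⟨b, hb, j, t, ht, rfl⟩ := hM.exists_hair hv
  have hh := hM.isHairyClique hb
  rcases (hh.map f hf).saturated hn hG ht hw with ⟨rfl, k, hk, rfl⟩ | rfl | ⟨h1, rfl⟩
  · exact ⟨_, hh.adj_base _ _ hk.symm, rfl⟩
  · exact ⟨_, hh.adj_succ _ _ ht, rfl⟩
  · refine ⟨_, ?_, rfl⟩
    have := (hh.adj_succ j (t - 1) (by omega)).symm
    rwa [Nat.sub_add_cancel h1] at this

theorem exists_cut_of_three_adj {v a b c : ℤ × Fin (n + 2)}
    (ha : (strandGraph n M).Adj v a) (hb : (strandGraph n M).Adj v b)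
    (hc : (strandGraph n M).Adj v c) (hab : a ≠ b) (hac : a ≠ c) (hbc : b ≠ c) :
    ∃ b, M b ≠ M (b + 1) ∧ (v.1 = b ∨ v.1 = b + 1) := by
  by_contra! hcon
  have key : ∀ u, (strandGraph n M).Adj v u → u = (v.1 + 1, v.2) ∨ u = (v.1 - 1, v.2) := by
    intro u hu
    rcases strandGraph_adj_cases hu with h | h | ⟨b, hb, h, -⟩
    · exact Or.inl h
    · exact Or.inr h
    · have := hcon b hb
      omega
  rcases key a ha with h1 | h1 <;> rcases key b hb with h2 | h2 <;>
    rcases key c hc with h3 | h3 <;> simp_all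

/-- A clique vertex has at most one neighbour outside its clique. -/
theorem fst_of_two_adj (hM : IsRunPattern n M) {v a c : ℤ × Fin (n + 2)} {b : ℤ}
    (hb : M b ≠ M (b + 1)) (hv : v.1 = b ∨ v.1 = b + 1)
    (ha : (strandGraph n M).Adj v a) (hc : (strandGraph n M).Adj v c) (hac : a ≠ c) :
    (a.1 = b ∨ a.1 = b + 1) ∨ (c.1 = b ∨ c.1 = b + 1) := by
  by_contra! hcon
  have key : ∀ u, (strandGraph n M).Adj v u → ¬ (u.1 = b ∨ u.1 = b + 1) →
      u = (if v.1 = b then b - 1 else b + 2, v.2) := by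
    intro u hu hub
    rcases strandGraph_adj_cases hu with rfl | rfl | ⟨b', hb', h1, h2⟩
    · simp only at hub
      rw [if_neg (by omega)]
      exact Prod.ext (by simp only; omega) rfl
    · simp only at hub
      rw [if_pos (by omega)]
      exact Prod.ext (by simp only; omega) rfl
    · have := hM.eq_of_near hb hb' (by omega) (by omega)
      omega
  exact hac ((key a ha (by omega)).trans (key c hc (by omega)).symm)

/-- A path of length at most `n` between two vertices of a clique stays in the clique. -/
theorem path_stays (hM : IsRunPattern n M) {b : ℤ} (hb : M b ≠ M (b + 1))
    {p : ℕ → ℤ × Fin (n + 2)} (hp : ∀ i ≤ n, ∀ k ≤ n, p i = p k → i = k)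
    (hadj : ∀ i < n, (strandGraph n M).Adj (p i) (p (i + 1)))
    (h0 : (p 0).1 = b ∨ (p 0).1 = b + 1) (h1 : (p n).1 = b ∨ (p n).1 = b + 1) :
    ∀ i ≤ n, (p i).1 = b ∨ (p i).1 = b + 1 := by
  have hdist : ∀ i ≤ n, (p i).1 ≤ (p 0).1 + i ∧ (p 0).1 ≤ (p i).1 + i := by
    intro i
    induction i with
    | zero => simp
    | succ i ih =>
      intro hi
      have := strandGraph_adj_fst (hadj i (by omega))
      have := ih (by omega)
      push_cast
      omega
  have key : ∀ ε : ℤ, (ε = 1 ∨ ε = -1) → ∀ m ≤ n, (∀ i ≤ n, ε * (p i).1 ≤ ε * (p m).1) →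
      (p m).1 = b ∨ (p m).1 = b + 1 := by
    intro ε hε m hm hmax
    by_contra hout
    have hm0 : m ≠ 0 := by rintro rfl; exact hout h0
    have hmn : m ≠ n := by rintro rfl; exact hout h1
    have hdm := hdist m hm
    have hi0 := hmax 0 (by omega)
    have hvert : ∀ i ≤ n, (strandGraph n M).Adj (p m) (p i) → p i = ((p m).1 - ε, (p m).2) := by
      intro i hi ha
      have hmi := hmax i hi
      rcases strandGraph_adj_cases ha with h | h | ⟨b', hb', e1, e2⟩
      · rcases hε with rfl | rfl
        · rw [h] at hmi; simp only at hmi; omega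
        · simpa using h
      · rcases hε with rfl | rfl
        · exact h
        · rw [h] at hmi; simp only at hmi; omega
      · have : b = b' := hM.eq_of_near hb hb' (by omega) (by omega)
        omega
    have e1 := hvert (m + 1) (by omega) (hadj m (by omega))
    have e2 := hvert (m - 1) (by omega) (by
      have := (hadj (m - 1) (by omega)).symm
      rwa [show m - 1 + 1 = m by omega] at this)
    have := hp _ (by omega) _ (by omega) (e1.trans e2.symm)
    omega
  have hext : ∀ ε : ℤ, ∃ m ≤ n, ∀ i ≤ n, ε * (p i).1 ≤ ε * (p m).1 := by
    intro ε
    obtain ⟨m, hm, hmax⟩ := Finset.exists_max_image (Finset.range (n + 1))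
      (fun i => ε * (p i).1) ⟨0, by simp⟩
    exact ⟨m, by simpa [Nat.lt_succ_iff] using hm,
      fun i hi => hmax i (by simpa [Nat.lt_succ_iff] using hi)⟩
  intro i hi
  obtain ⟨m, hm, hmax⟩ := hext 1
  obtain ⟨k, hk, hmin⟩ := hext (-1)
  have := key 1 (Or.inl rfl) m hm hmax
  have := key (-1) (Or.inr rfl) k hk hmin
  have := hmax i hi
  have := hmin i hi
  omega

theorem graphFree (hn : 1 ≤ n) (hM : IsRunPattern n M) :
    GraphFree (Bridge n) (strandGraph n M) := by
  intro hsub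
  obtain ⟨F, hF, ha, hb, hp, hd, he⟩ := exists_path_of_isSubgraphOf_bridge hsub
  have hne : ∀ u < n + 5, ∀ v < n + 5, u ≠ v → F u ≠ F v := fun u hu v hv huv e =>
    huv (hF u hu v hv e)
  obtain ⟨c, hc, h0⟩ := exists_cut_of_three_adj ha hb (hp 0 (by omega))
    (hne _ (by omega) _ (by omega) (by omega)) (hne _ (by omega) _ (by omega) (by omega))
    (hne _ (by omega) _ (by omega) (by omega))
  have hlast : (strandGraph n M).Adj (F (n + 2)) (F (n + 1)) := by
    have := (hp (n - 1) (by omega)).symm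
    rwa [show n - 1 + 2 = n + 1 by omega, show n - 1 + 3 = n + 2 by omega] at this
  obtain ⟨c', hc', h1⟩ := exists_cut_of_three_adj hd he hlast
    (hne _ (by omega) _ (by omega) (by omega)) (hne _ (by omega) _ (by omega) (by omega))
    (hne _ (by omega) _ (by omega) (by omega))
  have hdist : ∀ i ≤ n, (F (i + 2)).1 ≤ (F 2).1 + i ∧ (F 2).1 ≤ (F (i + 2)).1 + i := by
    intro i
    induction i with
    | zero => simp
    | succ i ih =>
      intro hi
      have h2 := strandGraph_adj_fst (hp i (by omega))
      have := ih (by omega)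
      rw [show i + 1 + 2 = i + 3 by omega]
      push_cast
      omega
  have hdn := hdist n le_rfl
  obtain rfl : c = c' := hM.eq_of_near hc hc' (by omega) (by omega)
  have hstay := hM.path_stays hc (p := fun i => F (i + 2))
    (fun i hi k hk e => by have := hF _ (by omega) _ (by omega) e; omega)
    (fun i hi => hp i hi) h0 h1
  obtain ⟨x, hx, hxc⟩ : ∃ x ≤ 1, (F x).1 = c ∨ (F x).1 = c + 1 := by
    rcases hM.fst_of_two_adj hc h0 ha hb (hne _ (by omega) _ (by omega) (by omega)) with h | h
    · exact ⟨0, by omega, h⟩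
    · exact ⟨1, by omega, h⟩
  obtain ⟨y, hy1, hy2, hyc⟩ : ∃ y, n + 3 ≤ y ∧ y ≤ n + 4 ∧ ((F y).1 = c ∨ (F y).1 = c + 1) := by
    rcases hM.fst_of_two_adj hc h1 hd he (hne _ (by omega) _ (by omega) (by omega)) with h | h
    · exact ⟨n + 3, by omega, by omega, h⟩
    · exact ⟨n + 4, by omega, by omega, h⟩
  have hon : ∀ i ≤ n, OnStrand M (F (i + 2)) := by
    intro i hi
    rcases Nat.lt_or_ge i n with h | h
    · exact (hp i h).1
    · obtain rfl : i = n := by omega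
      exact hd.1
  let e : ℕ → ℕ := fun i => if i = 0 then x else if i = n + 2 then y else i + 1
  have hprop : ∀ i < n + 3, e i < n + 5 ∧ OnStrand M (F (e i)) ∧
      ((F (e i)).1 = c ∨ (F (e i)).1 = c + 1) := by
    intro i hi
    simp only [e]
    split_ifs with h h'
    · refine ⟨by omega, ?_, hxc⟩
      obtain rfl | rfl : x = 0 ∨ x = 1 := by omega
      · exact ha.2.1
      · exact hb.2.1
    · refine ⟨by omega, ?_, hyc⟩
      obtain rfl | rfl : y = n + 3 ∨ y = n + 4 := by omega
      · exact hd.2.1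
      · exact he.2.1
    · obtain ⟨k, rfl⟩ : ∃ k, i = k + 1 := ⟨i - 1, by omega⟩
      exact ⟨by omega, hon k (by omega), hstay k (by omega)⟩
  have hcard := Fintype.card_le_of_injective (fun i : Fin (n + 3) => (F (e i)).2) (by
    intro i k hik
    obtain ⟨hi1, hi2, hi3⟩ := hprop i i.2
    obtain ⟨hk1, hk2, hk3⟩ := hprop k k.2
    have h2 := hF _ hi1 _ hk1 (OnStrand.eq_of_snd_eq hc hi2 hk2 hi3 hk3 hik)
    have hi := i.2
    have hk := k.2
    apply Fin.ext
    simp only [e] at h2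
    split_ifs at h2 <;> omega)
  simp at hcard

end IsRunPattern

/-- The used vertices whose level has absolute value at most `k`. -/
def levelBall (n : ℕ) (M : ℤ → Bool) (k : ℕ) : Set (ℤ × Fin (n + 2)) :=
  {v | OnStrand M v ∧ v.1.natAbs ≤ k}

theorem IsRunPattern.image_levelBall_succ {n : ℕ} {M : ℤ → Bool} (hn : 1 ≤ n)
    (hM : IsRunPattern n M) {W : Type*} {G : SimpleGraph W} (hG : GraphFree (Bridge n) G)
    (f : strandGraph n M →g G) (hf : Function.Injective f) (k : ℕ) :
    f '' levelBall n M (k + 1) =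
      f '' levelBall n M k ∪ {w | ∃ u ∈ f '' levelBall n M k, G.Adj u w} := by
  ext w
  constructor
  · rintro ⟨v, ⟨hv, hvk⟩, rfl⟩
    by_cases h : v.1.natAbs ≤ k
    · exact Or.inl ⟨v, ⟨hv, h⟩, rfl⟩
    · obtain ⟨u, hu, huv⟩ := exists_strandGraph_adj hv
        (s := if 0 ≤ v.1 then v.1 - 1 else v.1 + 1) (by split_ifs <;> omega)
      refine Or.inr ⟨f u, ⟨u, ⟨huv.1, ?_⟩, rfl⟩, f.map_adj huv⟩
      split_ifs at hu <;> omega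
  · rintro (⟨v, ⟨hv, hvk⟩, rfl⟩ | ⟨-, ⟨v, ⟨hv, hvk⟩, rfl⟩, hw⟩)
    · exact ⟨v, ⟨hv, by omega⟩, rfl⟩
    · obtain ⟨u, hvu, rfl⟩ := hM.exists_adj_of_adj_map hn hG f hf hv hw
      have := strandGraph_adj_fst hvu
      exact ⟨u, ⟨hvu.2.1, by omega⟩, rfl⟩

theorem levelBall_zero {n : ℕ} {M : ℤ → Bool} (h0 : M 0 = false) :
    levelBall n M 0 = {(0, 0)} := by
  ext ⟨r, j⟩
  simp only [levelBall, OnStrand, Set.mem_ofPred_eq, Set.mem_singleton_iff, Prod.mk.injEq]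
  constructor
  · rintro ⟨h, hr⟩
    obtain rfl : r = 0 := by omega
    exact ⟨rfl, h.2 h0⟩
  · rintro ⟨rfl, rfl⟩
    simp [h0]

/-- Rooted copies of two strand graphs with the same root in a bridge-free graph force the
colour patterns to agree. -/
theorem IsRunPattern.eq_true_of_map_eq {n : ℕ} {M N : ℤ → Bool} (hn : 1 ≤ n)
    (hM : IsRunPattern n M) (hN : IsRunPattern n N) (h0 : M 0 = false) (h0' : N 0 = false)
    (hsymm : ∀ r, M (-r) = M r) (hsymm' : ∀ r, N (-r) = N r)
    {W : Type*} {G : SimpleGraph W} (hG : GraphFree (Bridge n) G)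
    (f : strandGraph n M →g G) (hf : Function.Injective f)
    (g : strandGraph n N →g G) (hg : Function.Injective g)
    (hroot : f (0, 0) = g (0, 0)) (k : ℕ) (hk : M k = true) : N k = true := by
  have hball : ∀ k, f '' levelBall n M k = g '' levelBall n N k := by
    intro k
    induction k with
    | zero => simp [levelBall_zero h0, levelBall_zero h0', hroot]
    | succ k ih =>
      rw [hM.image_levelBall_succ hn hG f hf, hN.image_levelBall_succ hn hG g hg, ih]
  by_contra hk'
  rw [Bool.not_eq_true] at hk'
  have hlevel : ∀ v : ℤ × Fin (n + 2), v.1.natAbs = k → v.2 ≠ 0 →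
      f v = g (k, 0) ∨ f v = g (-k, 0) := by
    intro v hvk hv2
    have hMv : M v.1 = true := by
      obtain h | h : v.1 = k ∨ v.1 = -k := by omega
      · rw [h, hk]
      · rw [h, hsymm, hk]
    have hv : OnStrand M v := by simp [OnStrand, hMv, hv2]
    obtain ⟨u, ⟨hu, huk⟩, huv⟩ : f v ∈ g '' levelBall n N k := by
      rw [← hball]
      exact ⟨v, ⟨hv, hvk.le⟩, rfl⟩
    have hukk : u.1.natAbs = k := by
      by_contra hne
      have : g u ∈ f '' levelBall n M (k - 1) := by
        rw [hball]
        exact ⟨u, ⟨hu, by omega⟩, rfl⟩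
      obtain ⟨x, ⟨-, hx⟩, hxu⟩ := this
      have := hf (hxu.trans huv)
      subst this
      omega
    rw [← huv]
    obtain h | h : u.1 = k ∨ u.1 = -k := by omega
    · have hu2 : u.2 = 0 := hu.2 (by rw [h, hk'])
      exact Or.inl (congrArg g (Prod.ext h hu2))
    · have hu2 : u.2 = 0 := hu.2 (by rw [h, hsymm', hk'])
      exact Or.inr (congrArg g (Prod.ext h hu2))
  have hk0 : k ≠ 0 := by
    rintro rfl
    simp [h0] at hk
  have hlast : Fin.last (n + 1) ≠ 1 := by
    intro h
    have := congrArg Fin.val h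
    simp at this
    omega
  have d1 : f ((k : ℤ), 1) ≠ f (-(k : ℤ), 1) := fun h => by
    have := congrArg Prod.fst (hf h)
    simp only at this
    omega
  have d2 : f ((k : ℤ), 1) ≠ f ((k : ℤ), Fin.last (n + 1)) := fun h =>
    hlast (congrArg Prod.snd (hf h)).symm
  have d3 : f (-(k : ℤ), 1) ≠ f ((k : ℤ), Fin.last (n + 1)) := fun h =>
    hlast (congrArg Prod.snd (hf h)).symm
  have l1 := hlevel ((k : ℤ), 1) (by simp) (by simp)
  have l2 := hlevel (-(k : ℤ), 1) (by simp) (by simp)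
  have l3 := hlevel ((k : ℤ), Fin.last (n + 1)) (by simp) (by simp)
  grind

/-- The `2 n + 5`-periodic pattern whose runs of `true` start at the positions `≡ 1` and have
length `n + 2` or `n + 3`, as prescribed by `S`. -/
def pulse (n : ℕ) (S : ℕ → Bool) (x : ℤ) : Bool :=
  decide (1 ≤ x % (2 * n + 5) ∧
    x % (2 * n + 5) ≤ n + 2 + (if S (x / (2 * n + 5)).toNat then 1 else 0))

theorem pulse_eq_true_iff {n : ℕ} {S : ℕ → Bool} (k : ℤ) {x : ℤ}
    (h0 : (2 * n + 5) * k ≤ x) (h1 : x < (2 * n + 5) * k + (2 * n + 5)) :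
    pulse n S x = true ↔ 1 ≤ x - (2 * n + 5) * k ∧
      x - (2 * n + 5) * k ≤ n + 2 + (if S k.toNat then 1 else 0) := by
  obtain ⟨e1, e2⟩ := (Int.ediv_emod_unique (a := x) (b := 2 * n + 5)
    (r := x - (2 * n + 5) * k) (q := k) (by omega)).2 ⟨by ring, by omega, by omega⟩
  simp only [pulse, e1, e2, decide_eq_true_eq]

theorem isRunPattern_pulse {n : ℕ} (hn : 1 ≤ n) (S : ℕ → Bool) : IsRunPattern n (pulse n S) := by
  have window : ∀ b : ℤ, ∃ q d c e : ℤ, q ≤ b ∧ b < q + (2 * n + 5) ∧ (d = 0 ∨ d = 1) ∧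
      (c = 0 ∨ c = 1) ∧ (e = 0 ∨ e = 1) ∧
      (∀ x, q ≤ x → x < q + (2 * n + 5) →
        (pulse n S x = true ↔ 1 ≤ x - q ∧ x - q ≤ n + 2 + d)) ∧
      (∀ x, q - (2 * n + 5) ≤ x → x < q → (pulse n S x = true ↔
        1 ≤ x - (q - (2 * n + 5)) ∧ x - (q - (2 * n + 5)) ≤ n + 2 + c)) ∧
      (∀ x, q + (2 * n + 5) ≤ x → x < q + (2 * n + 5) + (2 * n + 5) → (pulse n S x = true ↔
        1 ≤ x - (q + (2 * n + 5)) ∧ x - (q + (2 * n + 5)) ≤ n + 2 + e)) := by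
    intro b
    have hP : (0 : ℤ) < 2 * n + 5 := by omega
    set k := b / (2 * n + 5) with hk
    have e1 : (2 * n + 5 : ℤ) * (k - 1) = (2 * n + 5) * k - (2 * n + 5) := by ring
    have e2 : (2 * n + 5 : ℤ) * (k + 1) = (2 * n + 5) * k + (2 * n + 5) := by ring
    refine ⟨(2 * n + 5) * k, if S k.toNat then 1 else 0, if S (k - 1).toNat then 1 else 0,
      if S (k + 1).toNat then 1 else 0, Int.mul_ediv_self_le hP.ne', ?_,
      by split_ifs <;> simp, by split_ifs <;> simp, by split_ifs <;> simp,
      fun x h1 h2 => pulse_eq_true_iff k h1 h2, fun x h1 h2 => ?_, fun x h1 h2 => ?_⟩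
    · exact Int.lt_mul_ediv_self_add hP
    · have := pulse_eq_true_iff (n := n) (S := S) (k - 1) (x := x) (by omega) (by omega)
      rwa [e1] at this
    · have := pulse_eq_true_iff (n := n) (S := S) (k + 1) (x := x) (by omega) (by omega)
      rwa [e2] at this
  have cut : ∀ b q d e : ℤ, q ≤ b → b < q + (2 * n + 5) → (d = 0 ∨ d = 1) →
      (∀ x, q ≤ x → x < q + (2 * n + 5) →
        (pulse n S x = true ↔ 1 ≤ x - q ∧ x - q ≤ n + 2 + d)) →
      (∀ x, q + (2 * n + 5) ≤ x → x < q + (2 * n + 5) + (2 * n + 5) → (pulse n S x = true ↔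
        1 ≤ x - (q + (2 * n + 5)) ∧ x - (q + (2 * n + 5)) ≤ n + 2 + e)) →
      (pulse n S b ≠ pulse n S (b + 1) ↔ b = q ∨ b = q + (n + 2 + d)) := by
    intro b q d e h1 h2 hd E0 E2
    rw [Ne, Bool.eq_iff_iff, E0 b h1 h2]
    rcases lt_or_ge (b + 1) (q + (2 * n + 5)) with h | h
    · rw [E0 (b + 1) (by omega) h]
      omega
    · rw [E2 (b + 1) h (by omega)]
      omega
  refine ⟨?_, ?_, ?_⟩
  · intro b hb i hi1 hi2
    obtain ⟨q, d, c, e, h1, h2, hd, hc, he, E0, E1, E2⟩ := window b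
    rw [cut b q d e h1 h2 hd E0 E2] at hb
    rw [Bool.eq_iff_iff, E0 (b + 1) (by omega) (by omega)]
    rcases lt_or_ge i (q + (2 * n + 5)) with h | h
    · rw [E0 i (by omega) h]
      omega
    · rw [E2 i h (by omega)]
      omega
  · intro b hb i hi1 hi2
    obtain ⟨q, d, c, e, h1, h2, hd, hc, he, E0, E1, E2⟩ := window b
    rw [cut b q d e h1 h2 hd E0 E2] at hb
    rw [Bool.eq_iff_iff, E0 b (by omega) (by omega)]
    rcases lt_or_ge i q with h | h
    · rw [E1 i (by omega) h]
      omega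
    · rw [E0 i h (by omega)]
      omega
  · intro r
    obtain ⟨q, d, c, e, h1, h2, hd, hc, he, E0, E1, E2⟩ := window r
    by_cases hr : r ≤ q + n + 1
    · exact ⟨q, (cut q q d e (by omega) (by omega) hd E0 E2).2 (Or.inl rfl), by omega, by omega⟩
    by_cases hr' : r ≤ q + 2 * n + 3 + d
    · exact ⟨q + (n + 2 + d), (cut _ q d e (by omega) (by omega) hd E0 E2).2 (Or.inr rfl),
        by omega, by omega⟩
    · refine ⟨q + (2 * n + 5), ?_, by omega, by omega⟩
      rw [Ne, Bool.eq_iff_iff, E2 _ (by omega) (by omega), E2 _ (by omega) (by omega)]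
      omega

/-- The pattern `pulse`, shifted by `n` and reflected at `0`. -/
def mirroredPulse (n : ℕ) (S : ℕ → Bool) (r : ℤ) : Bool :=
  pulse n S (r.natAbs - n)

theorem pulse_eq_false {n : ℕ} {S : ℕ → Bool} {x : ℤ} (h0 : -n - 1 ≤ x) (h1 : x ≤ 0) :
    pulse n S x = false := by
  rw [← Bool.not_eq_true]
  rcases eq_or_lt_of_le h1 with rfl | h
  · rw [pulse_eq_true_iff 0 (by omega) (by omega)]
    omega
  · rw [pulse_eq_true_iff (-1) (by omega) (by omega)]
    split_ifs <;> omega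

theorem pulse_one {n : ℕ} {S : ℕ → Bool} : pulse n S 1 = true := by
  rw [pulse_eq_true_iff 0 (by omega) (by omega)]
  split_ifs <;> omega

theorem mirroredPulse_neg {n : ℕ} {S : ℕ → Bool} (r : ℤ) :
    mirroredPulse n S (-r) = mirroredPulse n S r := by
  simp [mirroredPulse]

theorem mirroredPulse_of_neg_one_le {n : ℕ} (hn : 1 ≤ n) {S : ℕ → Bool} {r : ℤ} (hr : -1 ≤ r) :
    mirroredPulse n S r = pulse n S (r - n) := by
  rcases eq_or_lt_of_le hr with rfl | h
  · rw [mirroredPulse, pulse_eq_false (by omega) (by omega),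
      pulse_eq_false (by omega) (by omega)]
  · rw [mirroredPulse, Int.natAbs_of_nonneg (by omega)]

theorem isRunPattern_mirroredPulse {n : ℕ} (hn : 1 ≤ n) (S : ℕ → Bool) :
    IsRunPattern n (mirroredPulse n S) := by
  have hP := isRunPattern_pulse hn S
  have hcut : ∀ b : ℤ, 0 ≤ b → (mirroredPulse n S b ≠ mirroredPulse n S (b + 1) ↔
      pulse n S (b - n) ≠ pulse n S (b - n + 1)) := by
    intro b hb
    rw [mirroredPulse_of_neg_one_le hn (by omega), mirroredPulse_of_neg_one_le hn (by omega),
      show b + 1 - n = b - n + 1 by ring]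
  have hright : ∀ b : ℤ, 0 ≤ b → mirroredPulse n S b ≠ mirroredPulse n S (b + 1) →
      ∀ i, b + 1 ≤ i → i ≤ b + n + 2 → mirroredPulse n S i = mirroredPulse n S (b + 1) := by
    intro b hb hc i h1 h2
    have := hP.right _ ((hcut b hb).1 hc) (i - n) (by omega) (by omega)
    rwa [mirroredPulse_of_neg_one_le hn (by omega), mirroredPulse_of_neg_one_le hn (by omega),
      show b + 1 - n = b - n + 1 by ring]
  have hleft : ∀ b : ℤ, 0 ≤ b → mirroredPulse n S b ≠ mirroredPulse n S (b + 1) →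
      ∀ i, b - n - 1 ≤ i → i ≤ b → mirroredPulse n S i = mirroredPulse n S b := by
    intro b hb hc i h1 h2
    rw [hcut b hb] at hc
    have hbn : n ≤ b := by
      by_contra h
      exact hc ((pulse_eq_false (by omega) (by omega)).trans
        (pulse_eq_false (by omega) (by omega)).symm)
    rw [mirroredPulse_of_neg_one_le hn (by omega), mirroredPulse_of_neg_one_le hn (by omega)]
    exact hP.left _ hc (i - n) (by omega) (by omega)
  have hflip : ∀ b : ℤ, mirroredPulse n S b ≠ mirroredPulse n S (b + 1) →
      mirroredPulse n S (-b - 1) ≠ mirroredPulse n S (-b - 1 + 1) := by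
    intro b hb
    rw [← mirroredPulse_neg b, ← mirroredPulse_neg (b + 1)] at hb
    rw [show -b - 1 + 1 = -b by ring, show -b - 1 = -(b + 1) by ring]
    exact hb.symm
  refine ⟨?_, ?_, ?_⟩
  · intro b hb i h1 h2
    rcases le_or_gt 0 b with h | h
    · exact hright b h hb i h1 h2
    · have := hleft (-b - 1) (by omega) (hflip b hb) (-i) (by omega) (by omega)
      rwa [show -b - 1 = -(b + 1) by ring, mirroredPulse_neg, mirroredPulse_neg] at this
  · intro b hb i h1 h2
    rcases le_or_gt 0 b with h | h
    · exact hleft b h hb i h1 h2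
    · have := hright (-b - 1) (by omega) (hflip b hb) (-i) (by omega) (by omega)
      rwa [show -b - 1 + 1 = -b by ring, mirroredPulse_neg, mirroredPulse_neg] at this
  · intro r
    obtain ⟨b, hb0, hb, h1, h2⟩ : ∃ b : ℤ, 0 ≤ b ∧
        mirroredPulse n S b ≠ mirroredPulse n S (b + 1) ∧ b - n ≤ r.natAbs ∧
        r.natAbs ≤ b + n + 1 := by
      obtain ⟨b, hb, h1, h2⟩ := hP.near (r.natAbs - n)
      rcases le_or_gt 0 (b + n) with h | h
      · exact ⟨b + n, h, (hcut _ h).2 (by simpa using hb), by omega, by omega⟩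
      · refine ⟨n, by omega, (hcut _ (by omega)).2 ?_, by omega, by omega⟩
        rw [sub_self, zero_add, pulse_one, pulse_eq_false (by omega) le_rfl]
        simp
    rcases le_or_gt 0 r with h | h
    · exact ⟨b, hb, by omega, by omega⟩
    · exact ⟨-b - 1, hflip b hb, by omega, by omega⟩

theorem mirroredPulse_eq {n : ℕ} (hn : 1 ≤ n) {S : ℕ → Bool} (k : ℕ) :
    mirroredPulse n S (((2 * n + 5) * k + 2 * n + 3 : ℕ) : ℤ) = S k := by
  rw [mirroredPulse_of_neg_one_le hn (by omega), Bool.eq_iff_iff,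
    pulse_eq_true_iff k (by push_cast; omega) (by push_cast; omega)]
  push_cast
  simp only [Int.toNat_natCast]
  split_ifs with h <;> simp only [h, iff_true, Bool.false_eq_true, iff_false] <;> omega

/-- For every `n ≥ 1` there is no universal countable `B_n`-free graph:
    no countable `B_n`-free graph `G` admits an isomorphic copy of every countable
    `B_n`-free graph as a (not necessarily induced) subgraph. -/
theorem no_universal_bridgeFree_graph (n : ℕ) (hn : 1 ≤ n) :
    ¬ ∃ (W : Type) (G : SimpleGraph W), Countable W ∧ GraphFree (Bridge n) G ∧
        ∀ (V : Type) (H : SimpleGraph V), Countable V → GraphFree (Bridge n) H →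
          IsSubgraphOf H G := by
  rintro ⟨W, G, hW, hG, huniv⟩
  have hM : ∀ S, IsRunPattern n (mirroredPulse n S) := isRunPattern_mirroredPulse hn
  choose f hf using fun S : ℕ → Bool =>
    huniv _ (strandGraph n (mirroredPulse n S)) inferInstance ((hM S).graphFree hn)
  have h0 : ∀ S, mirroredPulse n S 0 = false := fun S => by
    rw [mirroredPulse, pulse_eq_false] <;> simp
  have hle : ∀ S T, f S (0, 0) = f T (0, 0) → ∀ k, S k = true → T k = true := by
    intro S T hST k hk
    rw [← mirroredPulse_eq hn (S := S)] at hk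
    rw [← mirroredPulse_eq hn (S := T)]
    exact (hM S).eq_true_of_map_eq hn (hM T) (h0 S) (h0 T) mirroredPulse_neg mirroredPulse_neg
      hG (f S) (hf S) (f T) (hf T) hST _ hk
  have hinj : Function.Injective fun S => f S (0, 0) := by
    intro S T hST
    funext k
    rw [Bool.eq_iff_iff]
    exact ⟨hle S T hST k, hle T S hST.symm k⟩
  have hcount : Countable (ℕ → Bool) := hinj.countable
  rw [← Cardinal.mk_le_aleph0_iff] at hcount
  simp only [Cardinal.mk_pi, Cardinal.mk_bool, Cardinal.prod_const, Cardinal.mk_nat,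
    Cardinal.lift_id] at hcount
  exact absurd hcount (not_le.2 (Cardinal.cantor _))
end

section
/- For every n ≥ 1, the weak complexity of the class of countable B_n-free graphs equals 2^{ℵ_0}; in particular, for every set I of fewer than 2^{ℵ_0} countable B_n-free graphs there exists a countable B_n-free graph that is not isomorphic to a subgraph of any member of I. -/
open SimpleGraph

lemma bridge_isSubgraphOf {W : Type*} {G : SimpleGraph W} {n : ℕ} (q : ℕ → W)
    (a b d e : W) (hq : ∀ i < n, G.Adj (q i) (q (i + 1)))
    (hinj : ∀ i ≤ n, ∀ j ≤ n, q i = q j → i = j)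
    (ha : G.Adj (q 0) a) (hb : G.Adj (q 0) b) (hd : G.Adj (q n) d) (he : G.Adj (q n) e)
    (hab : a ≠ b) (had : a ≠ d) (hae : a ≠ e) (hbd : b ≠ d) (hbe : b ≠ e) (hde : d ≠ e)
    (hqa : ∀ i ≤ n, q i ≠ a) (hqb : ∀ i ≤ n, q i ≠ b)
    (hqd : ∀ i ≤ n, q i ≠ d) (hqe : ∀ i ≤ n, q i ≠ e) :
    IsSubgraphOf (Bridge n) G := by
  let r : ℕ → W := fun i =>
    if i = 0 then a else if i = 1 then b else if i = n + 3 then d else if i = n + 4 then e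
    else q (i - 2)
  have r0 : r 0 = a := rfl
  have r1 : r 1 = b := rfl
  have r3 : r (n + 3) = d := by simp [r]
  have r4 : r (n + 4) = e := by simp [r]
  have r2 : ∀ i ≤ n, r (i + 2) = q i := by
    intro i hi
    have h1 : i ≠ n + 1 := by omega
    have h2 : i ≠ n + 2 := by omega
    simp [r, h1, h2]
  have key : ∀ i < n + 5, (i = 0 ∧ r i = a) ∨ (i = 1 ∧ r i = b) ∨ (i = n + 3 ∧ r i = d) ∨
      (i = n + 4 ∧ r i = e) ∨ ∃ k ≤ n, i = k + 2 ∧ r i = q k := by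
    intro i hi
    by_cases h : 2 ≤ i ∧ i ≤ n + 2
    · obtain ⟨k, rfl⟩ : ∃ k, i = k + 2 := ⟨i - 2, by omega⟩
      exact Or.inr (Or.inr (Or.inr (Or.inr ⟨k, by omega, rfl, r2 k (by omega)⟩)))
    · obtain rfl | rfl | rfl | rfl : i = 0 ∨ i = 1 ∨ i = n + 3 ∨ i = n + 4 := by omega
      all_goals simp [r0, r1, r3, r4]
  have hadj : ∀ u v : ℕ, (u = 0 ∧ v = 2) ∨ (u = 1 ∧ v = 2) ∨
      (2 ≤ u ∧ u < n + 2 ∧ v = u + 1) ∨ (u = n + 2 ∧ v = n + 3) ∨ (u = n + 2 ∧ v = n + 4) →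
      G.Adj (r u) (r v) := by
    rintro u v (⟨rfl, rfl⟩ | ⟨rfl, rfl⟩ | ⟨h1, h2, rfl⟩ | ⟨rfl, rfl⟩ | ⟨rfl, rfl⟩)
    · rw [r0, r2 0 (by omega)]; exact ha.symm
    · rw [r1, r2 0 (by omega)]; exact hb.symm
    · obtain ⟨k, rfl⟩ : ∃ k, u = k + 2 := ⟨u - 2, by omega⟩
      rw [r2 k (by omega), show k + 2 + 1 = (k + 1) + 2 by ring, r2 (k + 1) (by omega)]
      exact hq k (by omega)
    · rw [r3, r2 n le_rfl]; exact hd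
    · rw [r4, r2 n le_rfl]; exact he
  refine ⟨⟨fun i => r i, ?_⟩, ?_⟩
  · intro u v huv
    rw [Bridge, SimpleGraph.fromRel_adj] at huv
    rcases huv.2 with h | h
    · exact hadj _ _ h
    · exact (hadj _ _ h).symm
  · intro u v huv
    replace huv : r u = r v := huv
    apply Fin.ext
    have hu := key u u.2
    have hv := key v v.2
    grind

section LinkGraph

variable {K ι : Type} (n : ℕ) (σ : K × ι → K × ι)

/-- Every `k : K` carries a clique on the darts `{k} × ι`, and each dart `d` is joined to the
dart `σ d` by a path of length `2 * n + 1`; the vertex `(d, j)` with `j ≤ n` is the one at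
distance `j` from the dart `d = (d, 0)`.  The vertices `(d, j)` with `n < j` are isolated. -/
def linkGraph : SimpleGraph ((K × ι) × ℕ) :=
  SimpleGraph.fromRel fun x y =>
    (x.2 = 0 ∧ y.2 = 0 ∧ x.1.1 = y.1.1) ∨ (x.1 = y.1 ∧ y.2 = x.2 + 1 ∧ y.2 ≤ n) ∨
      (x.2 = n ∧ y.2 = n ∧ y.1 = σ x.1)

/-- The `j`-th vertex on the path from the dart `d` to the dart `σ d`. -/
def linkVertex (d : K × ι) (j : ℕ) : (K × ι) × ℕ :=
  if j ≤ n then (d, j) else (σ d, 2 * n + 1 - j)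

variable {n σ}

lemma linkVertex_of_le {d : K × ι} {j : ℕ} (h : j ≤ n) : linkVertex n σ d j = (d, j) :=
  if_pos h

lemma linkVertex_of_lt {d : K × ι} {j : ℕ} (h : n < j) :
    linkVertex n σ d j = (σ d, 2 * n + 1 - j) :=
  if_neg (not_le.mpr h)

lemma linkGraph_adj_dart (hn : 1 ≤ n) (d : K × ι) (y : (K × ι) × ℕ) :
    (linkGraph n σ).Adj (d, 0) y ↔ y = (d, 1) ∨ ∃ e, e.1 = d.1 ∧ e ≠ d ∧ y = (e, 0) := by
  obtain ⟨e, j⟩ := y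
  simp only [linkGraph, SimpleGraph.fromRel_adj, Prod.mk.injEq, ne_eq]
  constructor
  · rintro ⟨h, h1⟩
    by_cases hj : j = 0
    · subst hj
      exact Or.inr ⟨e, by grind, by grind, rfl, rfl⟩
    · left; grind
  · rintro (⟨rfl, rfl⟩ | ⟨e', h1, h2, rfl, rfl⟩) <;> grind

variable (hn : 1 ≤ n) (hinv : Function.Involutive σ) (hfix : ∀ d, σ d ≠ d)
include hn hinv hfix

lemma linkGraph_adj_linkVertex {d : K × ι} {j : ℕ} (hj : j + 1 ≤ 2 * n) (y : (K × ι) × ℕ) :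
    (linkGraph n σ).Adj (linkVertex n σ d (j + 1)) y ↔
      y = linkVertex n σ d j ∨ y = linkVertex n σ d (j + 2) := by
  have h1 := hinv d
  have h2 := hfix d
  obtain ⟨e, i⟩ := y
  have h3 := hinv e
  simp only [linkGraph, SimpleGraph.fromRel_adj, linkVertex]
  rcases lt_trichotomy (j + 1) n with h | h | h
  · rw [if_pos (by omega), if_pos (by omega), if_pos (by omega)]
    simp only [Prod.mk.injEq, ne_eq]
    grind
  · rw [if_pos (by omega), if_pos (by omega), if_neg (by omega)]
    simp only [Prod.mk.injEq, ne_eq]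
    grind
  · rw [if_neg (by omega), if_neg (by omega : ¬ j + 2 ≤ n)]
    by_cases h' : j ≤ n
    · rw [if_pos h']
      simp only [Prod.mk.injEq, ne_eq]
      grind
    · rw [if_neg h']
      simp only [Prod.mk.injEq, ne_eq]
      grind

omit hn hinv in
lemma linkVertex_ne_add_two {d : K × ι} {j : ℕ} (hj : j + 1 ≤ 2 * n) :
    linkVertex n σ d j ≠ linkVertex n σ d (j + 2) := by
  have h2 := hfix d
  unfold linkVertex
  intro h
  split_ifs at h <;> simp only [Prod.mk.injEq] at h <;> grind

omit hn hinv hfix in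
lemma exists_enumeration [Fintype ι] (hn : 1 ≤ n) (hc : Fintype.card ι = n + 2) {i₀ u : ι}
    (hu : u ≠ i₀) :
    ∃ g : ℕ → ι, g 0 = i₀ ∧ g n = u ∧ ∀ i < n + 2, ∀ j < n + 2, g i = g j → i = j := by
  classical
  let e : Fin (n + 2) ≃ ι := (Fintype.equivFinOfCardEq hc).symm
  let e₁ : Fin (n + 2) ≃ ι := (Equiv.swap 0 (e.symm i₀)).trans e
  have h₁ : e₁ 0 = i₀ := by simp [e₁]
  let l : Fin (n + 2) := ⟨n, by omega⟩
  let e₂ : Fin (n + 2) ≃ ι := (Equiv.swap l (e₁.symm u)).trans e₁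
  have h₂ : e₂ l = u := by simp [e₂]
  have h₃ : e₂ 0 = i₀ := by
    have h4 : (0 : Fin (n + 2)) ≠ l := by
      intro h; have := congrArg Fin.val h; simp [l] at this; omega
    have h5 : (0 : Fin (n + 2)) ≠ e₁.symm u := by
      intro h; apply hu; rw [← h₁, h]; simp
    simp only [e₂, Equiv.trans_apply, Equiv.swap_apply_of_ne_of_ne h4 h5, h₁]
  refine ⟨fun i => if h : i < n + 2 then e₂ ⟨i, h⟩ else i₀, by simpa using h₃, by simpa using h₂,
    ?_⟩
  intro i hi j hj hij
  simpa [hi, hj] using hij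

omit hinv hfix in
lemma exists_adj_of_adj_dart [Fintype ι] (hc : Fintype.card ι = n + 2) {W : Type*}
    {G : SimpleGraph W} (hG : GraphFree (Bridge n) G) {f : linkGraph n σ →g G}
    (hf : Function.Injective f) {d : K × ι} {p : W} (hp : G.Adj (f (d, 0)) p) :
    ∃ y, (linkGraph n σ).Adj (d, 0) y ∧ f y = p := by
  by_contra hcon
  push Not at hcon
  have hclique : ∀ e e' : K × ι, e.1 = e'.1 → e ≠ e' →
      (linkGraph n σ).Adj (e, 0) (e', 0) := fun e e' h h' =>
    (linkGraph_adj_dart hn _ _).2 (Or.inr ⟨e', h.symm, h'.symm, rfl⟩)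
  have hout : ∀ e : K × ι, (linkGraph n σ).Adj (e, 0) (e, 1) := fun e =>
    (linkGraph_adj_dart hn _ _).2 (Or.inl rfl)
  obtain ⟨u, hu, hup⟩ : ∃ u, u ≠ d.2 ∧ f ((d.1, u), 1) ≠ p := by
    by_contra h
    push Not at h
    obtain ⟨a, b, c, hab, hac, hbc⟩ := Fintype.two_lt_card_iff.1 (by omega : 2 < Fintype.card ι)
    have key : ∀ u v, u ≠ d.2 → v ≠ d.2 → u = v := by
      intro u v hu hv
      have := hf ((h u hu).trans (h v hv).symm)
      simpa using this
    by_cases ha : a = d.2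
    · exact hbc (key b c (fun h => hab (ha.trans h.symm)) (fun h => hac (ha.trans h.symm)))
    · have hb : b = d.2 := by_contra fun hb => hab (key a b ha hb)
      exact hac (key a c ha (fun h => hbc (hb.trans h.symm)))
  obtain ⟨g, g0, gn, ginj⟩ := exists_enumeration hn hc hu
  have hd : ((d.1, g 0), 0) = (d, 0) := by rw [g0]
  have hpc : ∀ i, f ((d.1, g i), 0) ≠ p := by
    intro i h
    by_cases hi : g i = d.2
    · rw [hi] at h
      exact hp.ne h
    · exact hcon _ (hclique d (d.1, g i) rfl (fun h => hi (by rw [h]))) h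
  refine hG (bridge_isSubgraphOf (fun i => f ((d.1, g i), 0)) p (f (d, 1)) (f ((d.1, u), 1))
    (f ((d.1, g (n + 1)), 0)) ?_ ?_ ?_ ?_ ?_ ?_ ?_ ?_ ?_ ?_ ?_ ?_ ?_ ?_ ?_ ?_)
  · intro i hi
    refine f.map_adj (hclique _ _ rfl fun h => ?_)
    have := ginj i (by omega) (i + 1) (by omega) (congrArg Prod.snd h)
    omega
  · intro i hi j hj h
    exact ginj i (by omega) j (by omega) (by simpa using hf h)
  · simpa only [hd] using hp
  · simpa only [hd] using f.map_adj (hout d)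
  · rw [gn]; exact f.map_adj (hout _)
  · refine f.map_adj (hclique _ _ rfl fun h => ?_)
    have := ginj n (by omega) (n + 1) (by omega) (congrArg Prod.snd h)
    omega
  · exact (hcon _ (hout d)).symm
  · exact hup.symm
  · exact (hpc _).symm
  · intro h
    exact hu (congrArg (fun x => x.1.2) (hf h)).symm
  · intro h
    simpa using hf h
  · intro h
    simpa using hf h
  · exact fun i _ => hpc i
  · intro i _ h
    simpa using hf h
  · intro i _ h
    simpa using hf h
  · intro i hi h
    have := ginj i (by omega) (n + 1) (by omega) (congrArg (fun x => x.1.2) (hf h))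
    omega

omit hinv in
lemma bridge_isSubgraphOf_of_adj_link [Fintype ι] (hc : Fintype.card ι = n + 2) {W : Type*}
    {G : SimpleGraph W} {f : linkGraph n σ →g G} (hf : Function.Injective f) {d : K × ι} {j : ℕ}
    (hj : 1 ≤ j) (hjn : j ≤ n) {p : W} (hp : G.Adj (f (d, j)) p) (hpc : ∀ e, f (e, 0) ≠ p)
    (hpl : ∀ i < j, f (d, i) ≠ p) (hps : f (linkVertex n σ d (j + 1)) ≠ p)
    (hadj : (linkGraph n σ).Adj (d, j) (linkVertex n σ d (j + 1))) :
    IsSubgraphOf (Bridge n) G := by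
  have hclique : ∀ e e' : K × ι, e.1 = e'.1 → e ≠ e' →
      (linkGraph n σ).Adj (e, 0) (e', 0) := fun e e' h h' =>
    (linkGraph_adj_dart hn _ _).2 (Or.inr ⟨e', h.symm, h'.symm, rfl⟩)
  have hlink : ∀ i < n, (linkGraph n σ).Adj (d, i + 1) (d, i) := by
    intro i hi
    simp only [linkGraph, SimpleGraph.fromRel_adj]
    grind
  have hs : linkVertex n σ d (j + 1) = (d, j + 1) ∨ linkVertex n σ d (j + 1) = (σ d, n) := by
    rcases Nat.lt_or_ge j n with h | h
    · exact Or.inl (linkVertex_of_le h)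
    · right
      rw [linkVertex_of_lt (by omega)]
      congr 1
      omega
  generalize linkVertex n σ d (j + 1) = s at *
  have hfd := hfix d
  obtain ⟨u, hu⟩ := Fintype.exists_ne_of_one_lt_card (by omega : 1 < Fintype.card ι) d.2
  obtain ⟨g, g0, -, ginj⟩ := exists_enumeration hn hc hu
  have hd : (d.1, g 0) = d := by rw [g0]
  have hgstep : ∀ i, i + 1 < n + 2 →
      (linkGraph n σ).Adj ((d.1, g i), 0) ((d.1, g (i + 1)), 0) := by
    intro i hi
    refine hclique _ _ rfl fun h => ?_
    have := ginj i (by omega) (i + 1) (by omega) (congrArg Prod.snd h)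
    omega
  let q : ℕ → (K × ι) × ℕ := fun i => if i < j then (d, j - i) else ((d.1, g (i - j)), 0)
  have q1 : ∀ i < j, q i = (d, j - i) := fun i hi => if_pos hi
  have q2 : ∀ i, j ≤ i → q i = ((d.1, g (i - j)), 0) := fun i hi => if_neg (by omega)
  have hqs : ∀ i, q i ≠ s := by
    intro i h
    rcases Nat.lt_or_ge i j with h' | h'
    · rw [q1 i h'] at h
      grind
    · rw [q2 i h'] at h
      grind
  have hqg : ∀ i ≤ n, ∀ k, n - j < k → k < n + 2 → q i ≠ ((d.1, g k), 0) := by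
    intro i hi k hk hk' h
    rcases Nat.lt_or_ge i j with h' | h'
    · rw [q1 i h'] at h
      grind
    · rw [q2 i h'] at h
      have := ginj (i - j) (by omega) k (by omega) (congrArg (fun x => x.1.2) h)
      omega
  have hsg : ∀ e, s ≠ (e, 0) := by grind
  refine bridge_isSubgraphOf (fun i => f (q i)) p (f s) (f ((d.1, g (n - j + 1)), 0))
    (f ((d.1, g (n - j + 2)), 0)) ?_ ?_ ?_ ?_ ?_ ?_ ?_ ?_ ?_ ?_ ?_ ?_ ?_ ?_ ?_ ?_
  · intro i hi
    refine f.map_adj ?_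
    rcases lt_trichotomy (i + 1) j with h | h | h
    · rw [q1 i (by omega), q1 (i + 1) h]
      have := hlink (j - (i + 1)) (by omega)
      rwa [show j - (i + 1) + 1 = j - i by omega] at this
    · rw [q1 i (by omega), q2 (i + 1) (by omega), h, Nat.sub_self, hd,
        show j - i = 0 + 1 by omega]
      exact hlink 0 (by omega)
    · rw [q2 i (by omega), q2 (i + 1) (by omega), show i + 1 - j = i - j + 1 by omega]
      exact hgstep _ (by omega)
  · intro i hi k hk h
    replace h := hf h
    rcases Nat.lt_or_ge i j with h' | h'
    · rw [q1 i h'] at h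
      rcases Nat.lt_or_ge k j with h'' | h''
      · rw [q1 k h''] at h
        grind
      · rw [q2 k h''] at h
        grind
    · rw [q2 i h'] at h
      rcases Nat.lt_or_ge k j with h'' | h''
      · rw [q1 k h''] at h
        grind
      · rw [q2 k h''] at h
        have := ginj (i - j) (by omega) (k - j) (by omega) (congrArg (fun x => x.1.2) h)
        omega
  · simpa only [q1 0 hj, Nat.sub_zero] using hp
  · simpa only [q1 0 hj, Nat.sub_zero] using f.map_adj hadj
  · refine f.map_adj ?_
    rw [q2 n hjn]
    exact hgstep _ (by omega)
  · refine f.map_adj ?_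
    rw [q2 n hjn]
    refine hclique _ _ rfl fun h => ?_
    have := ginj (n - j) (by omega) (n - j + 2) (by omega) (congrArg Prod.snd h)
    omega
  · exact hps.symm
  · exact (hpc _).symm
  · exact (hpc _).symm
  · exact fun h => hsg _ (hf h)
  · exact fun h => hsg _ (hf h)
  · intro h
    have := ginj (n - j + 1) (by omega) (n - j + 2) (by omega) (congrArg (fun x => x.1.2) (hf h))
    omega
  · intro i hi
    rcases Nat.lt_or_ge i j with h | h
    · simp only [q1 i h]
      by_cases h0 : i = 0
      · subst h0
        exact hp.ne
      · exact hpl _ (by omega)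
    · simp only [q2 i h]
      exact hpc _
  · exact fun i _ h => hqs i (hf h)
  · exact fun i hi h => hqg i hi _ (by omega) (by omega) (hf h)
  · exact fun i hi h => hqg i hi _ (by omega) (by omega) (hf h)

lemma exists_adj_of_adj [Fintype ι] (hc : Fintype.card ι = n + 2) {W : Type*}
    {G : SimpleGraph W} (hG : GraphFree (Bridge n) G) {f : linkGraph n σ →g G}
    (hf : Function.Injective f) {d : K × ι} {j : ℕ} (hj : j ≤ n) {p : W}
    (hp : G.Adj (f (d, j)) p) :
    ∃ y, (linkGraph n σ).Adj (d, j) y ∧ f y = p := by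
  rcases Nat.eq_zero_or_pos j with rfl | hj0
  · exact exists_adj_of_adj_dart hn hc hG hf hp
  by_contra hcon
  push Not at hcon
  have hnext : ∀ i, 1 ≤ i → i ≤ n → (linkGraph n σ).Adj (d, i) (linkVertex n σ d (i + 1)) := by
    intro i hi hin
    obtain ⟨k, rfl⟩ : ∃ k, i = k + 1 := ⟨i - 1, by omega⟩
    rw [← linkVertex_of_le (σ := σ) hin, linkGraph_adj_linkVertex hn hinv hfix (by omega)]
    exact Or.inr rfl
  have hpc : ∀ e, f (e, 0) ≠ p := by
    rintro e rfl
    obtain ⟨y, hy, hfy⟩ := exists_adj_of_adj_dart hn hc hG hf hp.symm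
    rw [hf hfy] at hy
    exact hcon _ hy.symm rfl
  by_cases hpl : ∀ i < j, f (d, i) ≠ p
  · exact hG (bridge_isSubgraphOf_of_adj_link hn hfix hc hf hj0 hj hp hpc hpl
      (hcon _ (hnext j hj0 hj)) (hnext j hj0 hj))
  · push Not at hpl
    obtain ⟨i, hij, rfl⟩ := hpl
    have hi0 : 1 ≤ i := by
      by_contra h
      obtain rfl : i = 0 := by omega
      exact hpc d rfl
    have hne : linkVertex n σ d (i + 1) ≠ (d, j) := by
      intro h
      apply hcon (d, i) _ rfl
      rw [← h]
      exact (hnext i hi0 (by omega)).symm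
    refine hG (bridge_isSubgraphOf_of_adj_link hn hfix hc hf hi0 (by omega) hp.symm ?_ ?_
      (fun h => hne (hf h)) (hnext i hi0 (by omega)))
    · intro e h
      have := hf h
      grind
    · intro k hk h
      have := hf h
      grind

/-- A vertex inside a link has at most two neighbours. -/
lemma snd_eq_zero_of_adj_three {x y₁ y₂ y₃ : (K × ι) × ℕ} (hx : x.2 ≤ n)
    (h₁ : (linkGraph n σ).Adj x y₁) (h₂ : (linkGraph n σ).Adj x y₂)
    (h₃ : (linkGraph n σ).Adj x y₃) (h₁₂ : y₁ ≠ y₂) (h₁₃ : y₁ ≠ y₃) (h₂₃ : y₂ ≠ y₃) :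
    x.2 = 0 := by
  obtain ⟨d, j⟩ := x
  by_contra hj
  obtain ⟨k, rfl⟩ : ∃ k, j = k + 1 := Nat.exists_eq_succ_of_ne_zero hj
  rw [← linkVertex_of_le (σ := σ) hx] at h₁ h₂ h₃
  have hk : k + 1 ≤ 2 * n := by simp only at hx; omega
  rw [linkGraph_adj_linkVertex hn hinv hfix hk] at h₁ h₂ h₃
  grind

omit hn hinv hfix in
lemma snd_le_of_adj {x y : (K × ι) × ℕ} (h : (linkGraph n σ).Adj x y) : x.2 ≤ n := by
  simp only [linkGraph, SimpleGraph.fromRel_adj] at h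
  omega

/-- A path of length at most `n` that leaves a clique does not end at a dart. -/
lemma snd_path_ne_zero {P : ℕ → (K × ι) × ℕ} {m : ℕ} (hm : 1 ≤ m) (hmn : m ≤ n)
    (hP : ∀ i < m, (linkGraph n σ).Adj (P i) (P (i + 1)))
    (hinj : ∀ i ≤ m, ∀ j ≤ m, P i = P j → i = j) {d : K × ι} (h0 : P 0 = (d, 0))
    (h1 : P 1 = (d, 1)) : (P m).2 ≠ 0 := by
  have key : ∀ i, i + 1 ≤ m → P i = (d, i) ∧ P (i + 1) = (d, i + 1) := by
    intro i
    induction i with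
    | zero => exact fun _ => ⟨h0, h1⟩
    | succ i ih =>
      intro hi
      obtain ⟨ih₁, ih₂⟩ := ih (by omega)
      refine ⟨ih₂, ?_⟩
      have h := hP (i + 1) (by omega)
      rw [ih₂, ← linkVertex_of_le (σ := σ) (by omega : i + 1 ≤ n),
        linkGraph_adj_linkVertex hn hinv hfix (by omega), linkVertex_of_le (by omega),
        linkVertex_of_le (by omega)] at h
      rcases h with h | h
      · have := hinj (i + 1 + 1) (by omega) i (by omega) (h.trans ih₁.symm)
        omega
      · exact h
  obtain ⟨k, rfl⟩ : ∃ k, m = k + 1 := ⟨m - 1, by omega⟩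
  rw [(key k le_rfl).2]
  exact Nat.succ_ne_zero k

lemma linkGraph_bridgeFree [Fintype ι] (hc : Fintype.card ι = n + 2) :
    GraphFree (Bridge n) (linkGraph n σ) := by
  rintro ⟨φ, hφ⟩
  let r : ℕ → (K × ι) × ℕ := fun i => if h : i < n + 5 then φ ⟨i, h⟩ else φ 0
  have rinj : ∀ i < n + 5, ∀ j < n + 5, r i = r j → i = j := by
    intro i hi j hj h
    simp only [r, dif_pos hi, dif_pos hj] at h
    exact congrArg Fin.val (hφ h)
  have radj : ∀ u v : ℕ, u < n + 5 → v < n + 5 → u ≠ v → ((u = 0 ∧ v = 2) ∨ (u = 1 ∧ v = 2) ∨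
      (2 ≤ u ∧ u < n + 2 ∧ v = u + 1) ∨ (u = n + 2 ∧ v = n + 3) ∨ (u = n + 2 ∧ v = n + 4)) →
      (linkGraph n σ).Adj (r u) (r v) := by
    intro u v hu hv huv h
    simp only [r, dif_pos hu, dif_pos hv]
    refine φ.map_adj ?_
    rw [Bridge, SimpleGraph.fromRel_adj]
    exact ⟨fun h' => huv (congrArg Fin.val h'), Or.inl h⟩
  have hne : ∀ i < n + 5, ∀ j < n + 5, i ≠ j → r i ≠ r j := fun i hi j hj h h' =>
    h (rinj i hi j hj h')
  have hpath : ∀ i < n, (linkGraph n σ).Adj (r (i + 2)) (r (i + 3)) := fun i hi =>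
    radj _ _ (by omega) (by omega) (by omega) (by omega)
  have ha := radj 0 2 (by omega) (by omega) (by omega) (by omega)
  have hb := radj 1 2 (by omega) (by omega) (by omega) (by omega)
  have hd := radj (n + 2) (n + 3) (by omega) (by omega) (by omega) (by omega)
  have he := radj (n + 2) (n + 4) (by omega) (by omega) (by omega) (by omega)
  have hstart : (r 2).2 = 0 :=
    snd_eq_zero_of_adj_three hn hinv hfix (snd_le_of_adj ha.symm) ha.symm hb.symm
      (hpath 0 (by omega))
      (hne _ (by omega) _ (by omega) (by omega)) (hne _ (by omega) _ (by omega) (by omega))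
      (hne _ (by omega) _ (by omega) (by omega))
  have hend : (r (n + 2)).2 = 0 := by
    have h := hpath (n - 1) (by omega)
    rw [show n - 1 + 3 = n + 2 by omega] at h
    exact snd_eq_zero_of_adj_three hn hinv hfix (snd_le_of_adj hd) hd he h.symm
      (hne _ (by omega) _ (by omega) (by omega)) (hne _ (by omega) _ (by omega) (by omega))
      (hne _ (by omega) _ (by omega) (by omega))
  set k := (r 2).1.1 with hk
  have hmem : ∀ i ≤ n, (r (i + 2)).2 = 0 ∧ (r (i + 2)).1.1 = k := by
    intro i
    induction i with
    | zero => exact fun _ => ⟨hstart, rfl⟩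
    | succ i ih =>
      intro hi
      obtain ⟨ih₁, ih₂⟩ := ih (by omega)
      have h := hpath i (by omega)
      have hd0 : r (i + 2) = ((r (i + 2)).1, 0) := by rw [← ih₁]
      rw [hd0, linkGraph_adj_dart hn] at h
      rcases h with h | ⟨e, h1, -, h2⟩
      · refine absurd ?_ (snd_path_ne_zero hn hinv hfix (P := fun t => r (t + (i + 2)))
          (m := n - i) (by omega) (by omega) ?_ ?_ (d := (r (i + 2)).1) ?_ ?_)
        · rw [show n - i + (i + 2) = n + 2 by omega]
          exact hend
        · intro t ht
          have := hpath (t + i) (by omega)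
          rw [show t + 1 + (i + 2) = t + i + 3 by omega]
          exact this
        · intro s hs t ht hst
          have := rinj _ (by omega) _ (by omega) hst
          omega
        · simpa only [Nat.zero_add] using hd0
        · rw [← h]
          congr 1
          omega
      · rw [show i + 1 + 2 = i + 3 by omega, h2]
        exact ⟨rfl, h1.trans ih₂⟩
  have hside : ∀ c u v : ℕ, u ≠ v → u < n + 5 → v < n + 5 → (r c).2 = 0 → (r c).1.1 = k →
      (linkGraph n σ).Adj (r c) (r u) → (linkGraph n σ).Adj (r c) (r v) →
      ((r u).2 = 0 ∧ (r u).1.1 = k) ∨ ((r v).2 = 0 ∧ (r v).1.1 = k) := by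
    intro c u v huv hu hv h0 hck hcu hcv
    have hd0 : r c = ((r c).1, 0) := by rw [← h0]
    rw [hd0, linkGraph_adj_dart hn] at hcu hcv
    rcases hcu with h | ⟨e, h1, -, h2⟩
    · rcases hcv with h' | ⟨e, h1, -, h2⟩
      · exact absurd (h.trans h'.symm) (hne u hu v hv huv)
      · rw [h2]
        exact Or.inr ⟨rfl, h1.trans hck⟩
    · rw [h2]
      exact Or.inl ⟨rfl, h1.trans hck⟩
  obtain ⟨a, ha', hak⟩ : ∃ a, (a = 0 ∨ a = 1) ∧ (r a).2 = 0 ∧ (r a).1.1 = k := by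
    rcases hside 2 0 1 (by omega) (by omega) (by omega) hstart rfl ha.symm hb.symm with h | h
    · exact ⟨0, Or.inl rfl, h⟩
    · exact ⟨1, Or.inr rfl, h⟩
  obtain ⟨b, hb', hbk⟩ : ∃ b, (b = n + 3 ∨ b = n + 4) ∧ (r b).2 = 0 ∧ (r b).1.1 = k := by
    rcases hside (n + 2) (n + 3) (n + 4) (by omega) (by omega) (by omega) hend (hmem n le_rfl).2
      hd he with h | h
    · exact ⟨n + 3, Or.inl rfl, h⟩
    · exact ⟨n + 4, Or.inr rfl, h⟩
  let c : ℕ → ℕ := fun i => if i = 0 then a else if i = n + 2 then b else i + 1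
  have hcc : ∀ i < n + 3, c i < n + 5 ∧ (r (c i)).2 = 0 ∧ (r (c i)).1.1 = k := by
    intro i hi
    simp only [c]
    split_ifs with h1 h2
    · exact ⟨by omega, hak⟩
    · exact ⟨by omega, hbk⟩
    · obtain ⟨t, rfl⟩ : ∃ t, i = t + 1 := ⟨i - 1, by omega⟩
      exact ⟨by omega, hmem t (by omega)⟩
  have hcinj : ∀ i < n + 3, ∀ j < n + 3, c i = c j → i = j := by
    intro i hi j hj h
    simp only [c] at h
    split_ifs at h <;> omega
  have hinj : Function.Injective (fun i : Fin (n + 3) => (r (c i)).1.2) := by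
    intro i j hij
    obtain ⟨hi, hi0, hik⟩ := hcc i i.2
    obtain ⟨hj, hj0, hjk⟩ := hcc j j.2
    apply Fin.ext
    refine hcinj i i.2 j j.2 (rinj _ hi _ hj ?_)
    exact Prod.ext (Prod.ext (hik.trans hjk.symm) hij) (hi0.trans hj0.symm)
  have := Fintype.card_le_of_injective _ hinj
  rw [Fintype.card_fin, hc] at this
  omega

section CommonSupergraph

variable [Fintype ι] (hc : Fintype.card ι = n + 2) {τ : K × ι → K × ι}
  (hinv' : Function.Involutive τ) (hfix' : ∀ d, τ d ≠ d) {W : Type*} {G : SimpleGraph W}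
  (hG : GraphFree (Bridge n) G) {f : linkGraph n σ →g G} (hf : Function.Injective f)
  {g : linkGraph n τ →g G} (hg : Function.Injective g)
include hc hG hf hg

lemma snd_eq_zero_of_apply_eq_dart {x : (K × ι) × ℕ} (hx : x.2 ≤ n) {e : K × ι}
    (h : f x = g (e, 0)) : x.2 = 0 := by
  have lift : ∀ y, (linkGraph n τ).Adj (e, 0) y →
      ∃ z, (linkGraph n σ).Adj x z ∧ f z = g y := fun y hy =>
    exists_adj_of_adj hn hinv hfix hc hG hf hx (by
      have := g.map_adj hy
      rwa [← h] at this)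
  obtain ⟨u, v, hu, hv, huv⟩ : ∃ u v, u ≠ e.2 ∧ v ≠ e.2 ∧ u ≠ v := by
    have h0 := Fintype.two_lt_card_iff.1 (by omega : 2 < Fintype.card ι)
    obtain ⟨a, b, c, hab, hac, hbc⟩ := h0
    by_cases ha : a = e.2
    · exact ⟨b, c, fun h => hab (ha.trans h.symm), fun h => hac (ha.trans h.symm), hbc⟩
    · by_cases hb : b = e.2
      · exact ⟨a, c, ha, fun h => hbc (hb.trans h.symm), hac⟩
      · exact ⟨a, b, ha, hb, hab⟩
  obtain ⟨z₁, hz₁, h₁⟩ := lift (e, 1) ((linkGraph_adj_dart hn _ _).2 (Or.inl rfl))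
  obtain ⟨z₂, hz₂, h₂⟩ := lift ((e.1, u), 0) ((linkGraph_adj_dart hn _ _).2
    (Or.inr ⟨(e.1, u), rfl, fun h => hu (congrArg Prod.snd h), rfl⟩))
  obtain ⟨z₃, hz₃, h₃⟩ := lift ((e.1, v), 0) ((linkGraph_adj_dart hn _ _).2
    (Or.inr ⟨(e.1, v), rfl, fun h => hv (congrArg Prod.snd h), rfl⟩))
  refine snd_eq_zero_of_adj_three hn hinv hfix hx hz₁ hz₂ hz₃ ?_ ?_ ?_
  · rintro rfl
    simpa using hg (h₁.symm.trans h₂)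
  · rintro rfl
    simpa using hg (h₁.symm.trans h₃)
  · rintro rfl
    exact huv (by simpa using hg (h₂.symm.trans h₃))

include hinv' hfix'

omit hinv hfix in
lemma exists_clique_apply_eq {d d' e : K × ι} (h : f (d, 0) = g (d', 0)) (he : e.1 = d.1) :
    ∃ e', e'.1 = d'.1 ∧ f (e, 0) = g (e', 0) := by
  by_cases hed : e = d
  · exact ⟨d', rfl, hed ▸ h⟩
  have hadj := f.map_adj ((linkGraph_adj_dart hn d (e, 0)).2 (Or.inr ⟨e, he, hed, rfl⟩))
  rw [h] at hadj
  obtain ⟨y, hy, hgy⟩ := exists_adj_of_adj hn hinv' hfix' hc hG hg (Nat.zero_le n) hadj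
  rcases (linkGraph_adj_dart hn _ _).1 hy with rfl | ⟨e', he', -, rfl⟩
  · exact absurd (snd_eq_zero_of_apply_eq_dart hn hinv' hfix' hc hG hg hf hn hgy) one_ne_zero
  · exact ⟨e', he', hgy.symm⟩

lemma apply_partner_eq {d d' : K × ι} (h : f (d, 0) = g (d', 0)) :
    f (σ d, 0) = g (τ d', 0) := by
  have hstart : f (d, 1) = g (d', 1) := by
    have hadj := f.map_adj ((linkGraph_adj_dart hn d (d, 1)).2 (Or.inl rfl))
    rw [h] at hadj
    obtain ⟨y, hy, hgy⟩ := exists_adj_of_adj hn hinv' hfix' hc hG hg (Nat.zero_le n) hadj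
    rcases (linkGraph_adj_dart hn _ _).1 hy with rfl | ⟨e', -, -, rfl⟩
    · exact hgy.symm
    · exact absurd (snd_eq_zero_of_apply_eq_dart hn hinv hfix hc hG hf hg hn hgy.symm) one_ne_zero
  have key : ∀ j, j ≤ 2 * n → f (linkVertex n σ d j) = g (linkVertex n τ d' j) ∧
      f (linkVertex n σ d (j + 1)) = g (linkVertex n τ d' (j + 1)) := by
    intro j
    induction j with
    | zero =>
      intro _
      simp only [linkVertex_of_le (Nat.zero_le n), linkVertex_of_le (show 0 + 1 ≤ n from hn)]
      exact ⟨h, hstart⟩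
    | succ j ih =>
      intro hj
      obtain ⟨ih₁, ih₂⟩ := ih (by omega)
      refine ⟨ih₂, ?_⟩
      have hadj := f.map_adj ((linkGraph_adj_linkVertex (d := d) hn hinv hfix hj _).2 (Or.inr rfl))
      rw [ih₂] at hadj
      have hle : (linkVertex n τ d' (j + 1)).2 ≤ n := by
        unfold linkVertex
        split_ifs <;> simp only <;> omega
      obtain ⟨y, hy, hgy⟩ := exists_adj_of_adj hn hinv' hfix' hc hG hg hle hadj
      rcases (linkGraph_adj_linkVertex hn hinv' hfix' hj _).1 hy with rfl | rfl
      · exact absurd (hf (ih₁.trans hgy)) (linkVertex_ne_add_two hfix hj)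
      · exact hgy.symm
  have hlast := (key (2 * n) le_rfl).2
  rw [linkVertex_of_lt (by omega), linkVertex_of_lt (by omega), Nat.sub_self] at hlast
  exact hlast

end CommonSupergraph

end LinkGraph

/-- `Reach σ k₀ j k` says that the clique `k` can be reached from `k₀` by following `j` links. -/
def Reach {K ι : Type} (σ : K × ι → K × ι) (k₀ : K) : ℕ → K → Prop
  | 0, k => k = k₀
  | j + 1, k => ∃ d, Reach σ k₀ j d.1 ∧ (σ d).1 = k

lemma Reach.exists_apply_eq {K ι : Type} {n : ℕ} {σ τ : K × ι → K × ι} (hn : 1 ≤ n)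
    (hinv : Function.Involutive σ) (hfix : ∀ d, σ d ≠ d) (hinv' : Function.Involutive τ)
    (hfix' : ∀ d, τ d ≠ d) [Fintype ι] (hc : Fintype.card ι = n + 2) {W : Type*}
    {G : SimpleGraph W} (hG : GraphFree (Bridge n) G) {f : linkGraph n σ →g G}
    (hf : Function.Injective f) {g : linkGraph n τ →g G} (hg : Function.Injective g)
    {d₀ d₀' : K × ι} (h₀ : f (d₀, 0) = g (d₀', 0)) {j : ℕ} {d : K × ι}
    (h : Reach σ d₀.1 j d.1) : ∃ d', Reach τ d₀'.1 j d'.1 ∧ f (d, 0) = g (d', 0) := by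
  induction j generalizing d with
  | zero =>
    obtain ⟨d', hd', h'⟩ := exists_clique_apply_eq hn hc hinv' hfix' hG hf hg h₀ h
    exact ⟨d', hd', h'⟩
  | succ j ih =>
    obtain ⟨e, he, hed⟩ := h
    obtain ⟨e', he', hee⟩ := ih he
    have hpart := apply_partner_eq hn hinv hfix hc hinv' hfix' hG hf hg hee
    obtain ⟨d', hd', h'⟩ :=
      exists_clique_apply_eq hn hc hinv' hfix' hG hf hg hpart hed.symm
    exact ⟨d', ⟨e', he', hd'.symm⟩, h'⟩

section Tree

variable {J : Type} [DecidableEq J] (s t : J)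

open Classical in
/-- The nodes of two copies of the rooted tree of finite lists carry one dart `none` towards the
parent and darts `some i` towards the children `i :: l`; the two roots are linked to each other.
At the nodes `(false, l)` with `l ∈ S`, the links to the children `s :: l` and `t :: l` are
replaced by a link between the darts `some s` and `some t`, and one between the two children. -/
noncomputable def treePartner (S : Set (List J)) :
    (Bool × List J) × Option J → (Bool × List J) × Option J
  | ((b, l), some i) =>
    if b = false ∧ l ∈ S ∧ Equiv.swap s t i ≠ i then ((b, l), some (Equiv.swap s t i))
    else ((b, i :: l), none)
  | ((b, []), none) => ((!b, []), none)
  | ((b, i :: l), none) =>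
    if b = false ∧ l ∈ S ∧ Equiv.swap s t i ≠ i then ((b, Equiv.swap s t i :: l), none)
    else ((b, l), some i)

variable {s t}

lemma treePartner_involutive (S : Set (List J)) : Function.Involutive (treePartner s t S) := by
  rintro ⟨⟨b, l⟩, _ | i⟩
  · rcases l with _ | ⟨i, l⟩
    · simp [treePartner]
    · by_cases h : b = false ∧ l ∈ S ∧ Equiv.swap s t i ≠ i
      · have h' : b = false ∧ l ∈ S ∧
            Equiv.swap s t (Equiv.swap s t i) ≠ Equiv.swap s t i :=
          ⟨h.1, h.2.1, by rw [Equiv.swap_apply_self]; exact h.2.2.symm⟩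
        rw [treePartner, if_pos h, treePartner, if_pos h', Equiv.swap_apply_self]
      · rw [treePartner, if_neg h, treePartner, if_neg h]
  · by_cases h : b = false ∧ l ∈ S ∧ Equiv.swap s t i ≠ i
    · have h' : b = false ∧ l ∈ S ∧
          Equiv.swap s t (Equiv.swap s t i) ≠ Equiv.swap s t i :=
        ⟨h.1, h.2.1, by rw [Equiv.swap_apply_self]; exact h.2.2.symm⟩
      rw [treePartner, if_pos h, treePartner, if_pos h', Equiv.swap_apply_self]
    · rw [treePartner, if_neg h, treePartner, if_neg h]

lemma treePartner_ne (S : Set (List J)) (d : (Bool × List J) × Option J) :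
    treePartner s t S d ≠ d := by
  obtain ⟨⟨b, l⟩, _ | i⟩ := d
  · rcases l with _ | ⟨i, l⟩
    · simp [treePartner]
    · rw [treePartner]
      split_ifs with h
      · simpa using h.2.2
      · simp
  · rw [treePartner]
    split_ifs with h
    · simpa using h.2.2
    · simp

/-- The distance of a node from the root `(false, [])`. -/
def treeLevel (k : Bool × List J) : ℕ := k.2.length + if k.1 then 1 else 0

lemma treeLevel_treePartner_le (S : Set (List J)) (d : (Bool × List J) × Option J) :
    treeLevel (treePartner s t S d).1 ≤ treeLevel d.1 + 1 := by
  obtain ⟨⟨b, l⟩, _ | i⟩ := d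
  · rcases l with _ | ⟨i, l⟩
    · cases b <;> simp [treePartner, treeLevel]
    · rw [treePartner]
      split_ifs <;> simp only [treeLevel, List.length_cons] <;> omega
  · rw [treePartner]
    split_ifs <;> simp only [treeLevel, List.length_cons] <;> omega

lemma treeLevel_le_of_reach {S : Set (List J)} {j : ℕ} {k : Bool × List J}
    (h : Reach (treePartner s t S) (false, []) j k) : treeLevel k ≤ j := by
  induction j generalizing k with
  | zero =>
    rw [Reach] at h
    simp [h, treeLevel]
  | succ j ih =>
    obtain ⟨d, hd, rfl⟩ := h
    have := treeLevel_treePartner_le (s := s) (t := t) S d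
    have := ih hd
    omega

lemma mem_of_treePartner_fst_eq {S : Set (List J)} {d : (Bool × List J) × Option J}
    (h : (treePartner s t S d).1 = d.1) : d.1.1 = false ∧ d.1.2 ∈ S := by
  obtain ⟨⟨b, l⟩, _ | i⟩ := d
  · rcases l with _ | ⟨i, l⟩
    · simp [treePartner] at h
    · rw [treePartner] at h
      split_ifs at h with h'
      · exact absurd (by simpa using h) h'.2.2
      · simp at h
  · rw [treePartner] at h
    split_ifs at h with h'
    · exact ⟨h'.1, h'.2.1⟩
    · simp at h

/-- The nodes just off the spine of the tree, at the heights prescribed by `A`. -/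
def spineMarks (s t : J) (A : Set ℕ) : Set (List J) :=
  {l | ∃ k ∈ A, l = t :: List.replicate k s}

lemma reach_spineMarks (hst : s ≠ t) (A : Set ℕ) (k : ℕ) :
    Reach (treePartner s t (spineMarks s t A)) (false, []) (k + 1)
      (false, t :: List.replicate k s) := by
  have hnot : ∀ k, List.replicate k s ∉ spineMarks s t A := by
    rintro k ⟨m, -, h⟩
    have ht : t ∈ List.replicate k s := h ▸ List.mem_cons_self
    exact hst (List.eq_of_mem_replicate ht).symm
  have hstep : ∀ k i, (treePartner s t (spineMarks s t A)
      ((false, List.replicate k s), some i)).1 = (false, i :: List.replicate k s) := by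
    intro k i
    rw [treePartner, if_neg fun h => hnot k h.2.1]
  have hspine : ∀ k, Reach (treePartner s t (spineMarks s t A)) (false, []) k
      (false, List.replicate k s) := by
    intro k
    induction k with
    | zero => rfl
    | succ k ih => exact ⟨_, ih, hstep k s⟩
  exact ⟨_, hspine k, hstep k t⟩

lemma subset_of_apply_root_eq [Fintype J] {n : ℕ} (hn : 1 ≤ n) (hst : s ≠ t)
    (hc : Fintype.card (Option J) = n + 2) {A B : Set ℕ} {W : Type*} {G : SimpleGraph W}
    (hG : GraphFree (Bridge n) G) {f : linkGraph n (treePartner s t (spineMarks s t A)) →g G}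
    (hf : Function.Injective f) {g : linkGraph n (treePartner s t (spineMarks s t B)) →g G}
    (hg : Function.Injective g)
    (h₀ : f (((false, []), none), 0) = g (((false, []), none), 0)) : A ⊆ B := by
  intro k hk
  set σ := treePartner s t (spineMarks s t A) with hσ
  set τ := treePartner s t (spineMarks s t B) with hτ
  have hinv : Function.Involutive σ := treePartner_involutive _
  have hfix : ∀ d, σ d ≠ d := treePartner_ne _
  have hinv' : Function.Involutive τ := treePartner_involutive _
  have hfix' : ∀ d, τ d ≠ d := treePartner_ne _
  let d : (Bool × List J) × Option J := ((false, t :: List.replicate k s), some s)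
  have hloop : (σ d).1 = d.1 := by
    rw [hσ, treePartner, if_pos]
    exact ⟨rfl, ⟨k, hk, rfl⟩, by rw [Equiv.swap_apply_left]; exact hst.symm⟩
  have hd : Reach σ (false, []) (k + 1) d.1 := reach_spineMarks hst A k
  obtain ⟨d', hd', hdd'⟩ := Reach.exists_apply_eq hn hinv hfix hinv' hfix' hc hG hf hg h₀ hd
  have hloop' : (τ d').1 = d'.1 := by
    obtain ⟨e', he', hee'⟩ :=
      exists_clique_apply_eq hn hc hinv' hfix' hG hf hg hdd' hloop
    have h := apply_partner_eq hn hinv hfix hc hinv' hfix' hG hf hg hdd'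
    rw [hee'] at h
    rw [← he', ← (Prod.mk.inj (hg h)).1]
  obtain ⟨hfalse, k', hk', hl⟩ := mem_of_treePartner_fst_eq hloop'
  have hd'1 : d'.1 = (false, t :: List.replicate k' s) := Prod.ext hfalse hl
  have hle : k' ≤ k := by
    have := treeLevel_le_of_reach hd'
    simpa [hd'1, treeLevel] using this
  have hge : k ≤ k' := by
    have hr : Reach τ (false, []) (k' + 1) d'.1 := hd'1 ▸ reach_spineMarks hst B k'
    obtain ⟨e, he, hee⟩ :=
      Reach.exists_apply_eq hn hinv' hfix' hinv hfix hc hG hg hf h₀.symm hr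
    have hed : e = d := congrArg Prod.fst (hf (hee.symm.trans hdd'.symm))
    rw [hed] at he
    have := treeLevel_le_of_reach he
    simpa [d, treeLevel] using this
  rwa [le_antisymm hge hle]

end Tree

/-- Fewer than continuum many countable `B_n`-free graphs do not suffice. -/
lemma exists_bridgeFree_not_isSubgraphOf {n : ℕ} (hn : 1 ≤ n) (κ : Type) (Vf : κ → Type)
    (Gf : ∀ i, SimpleGraph (Vf i)) (hκ : Cardinal.mk κ < Cardinal.continuum)
    (hG : ∀ i, Countable (Vf i) ∧ GraphFree (Bridge n) (Gf i)) :
    ∃ (W : Type) (H : SimpleGraph W), Countable W ∧ GraphFree (Bridge n) H ∧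
      ∀ i, ¬ IsSubgraphOf H (Gf i) := by
  by_contra hcon
  push Not at hcon
  have hst : (0 : Fin (n + 1)) ≠ Fin.last n := by
    intro h
    have := congrArg Fin.val h
    simp at this
    omega
  have hc : Fintype.card (Option (Fin (n + 1))) = n + 2 := by simp
  let σ : Set ℕ → _ := fun A => treePartner 0 (Fin.last n) (spineMarks 0 (Fin.last n) A)
  let root : ((Bool × List (Fin (n + 1))) × Option (Fin (n + 1))) × ℕ :=
    (((false, []), none), 0)
  have hex : ∀ A, ∃ x : Σ i, Vf i, ∃ f : linkGraph n (σ A) →g Gf x.1,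
      Function.Injective f ∧ f root = x.2 := by
    intro A
    obtain ⟨i, f, hf⟩ := hcon _ (linkGraph n (σ A)) inferInstance
      (linkGraph_bridgeFree hn (treePartner_involutive _) (treePartner_ne _) hc)
    exact ⟨⟨i, f root⟩, f, hf, rfl⟩
  choose x hx using hex
  have hinj : Function.Injective x := by
    intro A B hAB
    obtain ⟨f, hf, hfr⟩ := hx A
    have hB := hx B
    rw [← hAB] at hB
    obtain ⟨g, hg, hgr⟩ := hB
    have h := hfr.trans hgr.symm
    exact Set.Subset.antisymm (subset_of_apply_root_eq hn hst hc (hG _).2 hf hg h)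
      (subset_of_apply_root_eq hn hst hc (hG _).2 hg hf h.symm)
  have hle := Cardinal.mk_le_of_injective hinj
  rw [Cardinal.mk_set, Cardinal.mk_nat, Cardinal.two_power_aleph0, Cardinal.mk_sigma] at hle
  have hsum : Cardinal.sum (fun i => Cardinal.mk (Vf i)) ≤ Cardinal.mk κ * Cardinal.aleph0 := by
    refine (Cardinal.sum_le_sum _ (fun _ => Cardinal.aleph0) fun i => ?_).trans ?_
    · have := (hG i).1
      exact Cardinal.mk_le_aleph0
    · simp
  exact absurd (hle.trans hsum)
    (not_le.mpr (Cardinal.mul_lt_of_lt Cardinal.aleph0_le_continuum hκ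
      Cardinal.aleph0_lt_continuum))

lemma Bridge.exists_adj {n : ℕ} (u : Fin (n + 5)) : ∃ v, (Bridge n).Adj u v := by
  obtain ⟨u, hu⟩ := u
  simp only [Bridge, SimpleGraph.fromRel_adj, ne_eq, Fin.ext_iff]
  have key : ∀ v (hv : v < n + 5), u ≠ v →
      ((u = 0 ∧ v = 2) ∨ (u = 1 ∧ v = 2) ∨ (2 ≤ u ∧ u < n + 2 ∧ v = u + 1) ∨
        (u = n + 2 ∧ v = n + 3) ∨ (v = n + 2 ∧ u = n + 3) ∨ (v = n + 2 ∧ u = n + 4)) →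
      ∃ v : Fin (n + 5), ¬ u = v ∧
        (((u = 0 ∧ (v : ℕ) = 2) ∨ (u = 1 ∧ (v : ℕ) = 2) ∨
          (2 ≤ u ∧ u < n + 2 ∧ (v : ℕ) = u + 1) ∨
          (u = n + 2 ∧ (v : ℕ) = n + 3) ∨ (u = n + 2 ∧ (v : ℕ) = n + 4)) ∨
        (((v : ℕ) = 0 ∧ u = 2) ∨ ((v : ℕ) = 1 ∧ u = 2) ∨
          (2 ≤ (v : ℕ) ∧ (v : ℕ) < n + 2 ∧ u = v + 1) ∨
          ((v : ℕ) = n + 2 ∧ u = n + 3) ∨ ((v : ℕ) = n + 2 ∧ u = n + 4))) := by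
    intro v hv huv h
    refine ⟨⟨v, hv⟩, huv, ?_⟩
    rcases h with h | h | h | h | h | h
    · exact Or.inl (Or.inl h)
    · exact Or.inl (Or.inr (Or.inl h))
    · exact Or.inl (Or.inr (Or.inr (Or.inl h)))
    · exact Or.inl (Or.inr (Or.inr (Or.inr (Or.inl h))))
    · exact Or.inr (Or.inr (Or.inr (Or.inr (Or.inl h))))
    · exact Or.inr (Or.inr (Or.inr (Or.inr (Or.inr h))))
  by_cases h1 : u < 2
  · exact key 2 (by omega) (by omega) (by omega)
  · by_cases h2 : u < n + 3
    · exact key (u + 1) (by omega) (by omega) (by omega)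
    · exact key (n + 2) (by omega) (by omega) (by omega)

lemma GraphFree.map_bridge {n : ℕ} {V W : Type*} {H : SimpleGraph V}
    (hH : GraphFree (Bridge n) H) (e : V ↪ W) : GraphFree (Bridge n) (H.map e) := by
  rintro ⟨φ, hφ⟩
  have hrange : ∀ u, ∃ v, e v = φ u := by
    intro u
    obtain ⟨v, huv⟩ := Bridge.exists_adj u
    obtain ⟨x, y, -, hx, -⟩ := (SimpleGraph.map_adj _ _ _ _).1 (φ.map_adj huv)
    exact ⟨x, hx⟩
  choose ψ hψ using hrange
  refine hH ⟨⟨ψ, ?_⟩, ?_⟩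
  · intro u v huv
    have h := φ.map_adj huv
    rwa [← hψ, ← hψ, SimpleGraph.map_adj_apply] at h
  · intro u v huv
    replace huv : ψ u = ψ v := huv
    apply hφ
    rw [← hψ, ← hψ, huv]

lemma mk_simpleGraph_nat_le : Cardinal.mk (SimpleGraph ℕ) ≤ Cardinal.continuum := by
  have hinj : Function.Injective (fun H : SimpleGraph ℕ => {p : ℕ × ℕ | H.Adj p.1 p.2}) := by
    intro H H' h
    ext u v
    exact Set.ext_iff.1 h (u, v)
  refine (Cardinal.mk_le_of_injective hinj).trans ?_
  simp

/-- The weak complexity of the class of countable `B_n`-free graphs equals `2^ℵ₀`: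
    no family of fewer than `2^ℵ₀` countable `B_n`-free graphs contains every countable
    `B_n`-free graph as a subgraph of one of its members, while some family of
    cardinality `2^ℵ₀` does. -/
theorem weak_complexity_bridgeFree (n : ℕ) (hn : 1 ≤ n) :
    (∀ (ι : Type) (Vf : ι → Type) (Gf : ∀ i, SimpleGraph (Vf i)),
        Cardinal.mk ι < Cardinal.continuum →
        (∀ i, Countable (Vf i) ∧ GraphFree (Bridge n) (Gf i)) →
        ∃ (W : Type) (H : SimpleGraph W), Countable W ∧ GraphFree (Bridge n) H ∧
          ∀ i, ¬ IsSubgraphOf H (Gf i)) ∧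
    (∃ (ι : Type) (Vf : ι → Type) (Gf : ∀ i, SimpleGraph (Vf i)),
        Cardinal.mk ι = Cardinal.continuum ∧
        (∀ i, Countable (Vf i) ∧ GraphFree (Bridge n) (Gf i)) ∧
        ∀ (W : Type) (H : SimpleGraph W), Countable W → GraphFree (Bridge n) H →
          ∃ i, IsSubgraphOf H (Gf i)) := by
  refine ⟨exists_bridgeFree_not_isSubgraphOf hn, ?_⟩
  let κ := {H : SimpleGraph ℕ // GraphFree (Bridge n) H}
  have hcover : ∀ (W : Type) (H : SimpleGraph W), Countable W → GraphFree (Bridge n) H →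
      ∃ i : κ, IsSubgraphOf H i.1 := by
    intro W H hW hH
    obtain ⟨e, he⟩ := exists_injective_nat W
    let e' : W ↪ ℕ := ⟨e, he⟩
    exact ⟨⟨H.map e', hH.map_bridge e'⟩, (SimpleGraph.Embedding.map e' H).toHom, he⟩
  refine ⟨κ, fun _ => ℕ, fun i => i.1, le_antisymm ?_ ?_, fun i => ⟨inferInstance, i.2⟩, hcover⟩
  · exact (Cardinal.mk_subtype_le _).trans mk_simpleGraph_nat_le
  · by_contra h
    obtain ⟨W, H, hW, hH, hnot⟩ := exists_bridgeFree_not_isSubgraphOf hn κ (fun _ => ℕ)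
      (fun i => i.1) (not_le.mp h) fun i => ⟨inferInstance, i.2⟩
    obtain ⟨i, hi⟩ := hcover W H hW hH
    exact hnot i hi
end

section
/- For all k ≥ 2, there is no universal countable graph in the class of all countable graphs omitting all cycles of length at most 2k: there is no countable graph G* with no cycles of length at most 2k such that every countable graph with no cycles of length at most 2k is isomorphic to a (not necessarily induced) subgraph of G*. -/
open SimpleGraph

/-- `G` omits all cycles of length at most `2k`:
    every cycle in `G` has length greater than `2k`. -/
def NoShortCycles (k : ℕ) {V : Type*} (G : SimpleGraph V) : Prop :=
  ∀ (v : V) (c : G.Walk v v), c.IsCycle → 2 * k < c.length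

/-- A sequence can be built greedily if each condition on the next term only depends on
    the earlier terms and can always be met. -/
theorem exists_greedy_sequence {β : Type*} [Inhabited β] (P : ℕ → (ℕ → β) → β → Prop)
    (hcongr : ∀ n f g y, (∀ m < n, f m = g m) → P n f y → P n g y)
    (hext : ∀ n f, (∀ m < n, P m f (f m)) → ∃ y, P n f y) :
    ∃ f : ℕ → β, ∀ n, P n f (f n) := by
  classical
  let next : ℕ → (ℕ → β) → β := fun n g => if h : ∃ y, P n g y then h.choose else default
  let F : ℕ → β := fun n => Nat.strongRec (motive := fun _ => β)
    (fun n ih => next n (fun m => if h : m < n then ih m h else default)) n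
  have hF : ∀ n, F n = next n (fun m => if m < n then F m else default) := by
    intro n
    simp only [F]
    rw [Nat.strongRec_eq]
    simp
  refine ⟨F, fun n => ?_⟩
  induction n using Nat.strong_induction_on with
  | _ n ih =>
    obtain ⟨y, hy⟩ := hext n F ih
    have agree : ∀ m < n, F m = (fun m => if m < n then F m else default) m := by
      intro m hm
      simp [hm]
    have hex : ∃ y, P n (fun m => if m < n then F m else default) y :=
      ⟨y, hcongr _ _ _ _ agree hy⟩
    apply hcongr n _ _ _ (fun m hm => (agree m hm).symm)
    rw [hF n]
    simp only [next, dif_pos hex]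
    exact hex.choose_spec

/-- In a graph whose degrees are at most `D`, balls of radius `L` have at most `(D + 1) ^ L`
    vertices. -/
theorem exists_finset_ball {V : Type*} [DecidableEq V] (G : SimpleGraph V) (D : ℕ)
    (nb : V → Finset V) (hnb : ∀ v w, G.Adj v w → w ∈ nb v) (hD : ∀ v, (nb v).card ≤ D)
    (L : ℕ) (v : V) :
    ∃ S : Finset V, S.card ≤ (D + 1) ^ L ∧
      ∀ (w : V) (p : G.Walk v w), p.length ≤ L → w ∈ S := by
  induction L generalizing v with
  | zero =>
    refine ⟨{v}, by simp, fun w p hp => ?_⟩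
    have := SimpleGraph.Walk.eq_of_length_eq_zero (Nat.le_zero.mp hp)
    simp [this]
  | succ L ih =>
    choose S hcard hS using ih
    refine ⟨insert v ((nb v).biUnion S), ?_, fun w p hp => ?_⟩
    · have h1 := Finset.card_biUnion_le_card_mul (nb v) S ((D + 1) ^ L) (fun u _ => hcard u)
      have h2 := Nat.mul_le_mul_right ((D + 1) ^ L) (hD v)
      have h3 := Finset.card_insert_le v ((nb v).biUnion S)
      have h4 : 1 ≤ (D + 1) ^ L := Nat.one_le_pow _ _ (by omega)
      rw [pow_succ]
      nlinarith
    · cases p with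
      | nil => simp
      | cons h q =>
        refine Finset.mem_insert_of_mem (Finset.mem_biUnion.mpr ⟨_, hnb _ _ h, hS _ _ q ?_⟩)
        simpa using hp

/-- The graph on the vertices below `n` in which every `x` is joined to `x - 1` and every
    `x ≥ N` is also joined to `(f x).1`, `(f x).2` and `(f x).2 + 1`. -/
def chordGraph (N : ℕ) (f : ℕ → ℕ × ℕ) (n : ℕ) : SimpleGraph ℕ :=
  SimpleGraph.fromRel fun x y => x < n ∧ y < n ∧
    (y + 1 = x ∨ N ≤ x ∧ (y = (f x).1 ∨ y = (f x).2 ∨ y = (f x).2 + 1))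

/-- The graph in which every `x` is joined to `x - 1` and every `x ≥ N` is also joined to
    `(f x).1` and to one of `(f x).2` and `(f x).2 + 1`, as prescribed by `α`. -/
def codeGraph (N : ℕ) (f : ℕ → ℕ × ℕ) (α : ℕ → Bool) : SimpleGraph ℕ :=
  SimpleGraph.fromRel fun x y =>
    y + 1 = x ∨ N ≤ x ∧ (y = (f x).1 ∨ y = (f x).2 + (α (x - N)).toNat)

/-- Every walk from `a` to `b` has length greater than `L`. -/
def FarApart {V : Type*} (G : SimpleGraph V) (L : ℕ) (a b : V) : Prop :=
  ∀ p : G.Walk a b, L < p.length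

theorem FarApart.ne {V : Type*} {G : SimpleGraph V} {L : ℕ} {a b : V} (h : FarApart G L a b) :
    a ≠ b := by
  rintro rfl
  exact absurd (h SimpleGraph.Walk.nil) (by simp)

theorem FarApart.symm {V : Type*} {G : SimpleGraph V} {L : ℕ} {a b : V}
    (h : FarApart G L a b) : FarApart G L b a := fun p => by
  simpa using h p.reverse

theorem FarApart.mono {V : Type*} {G : SimpleGraph V} {L M : ℕ} {a b : V}
    (h : FarApart G M a b) (hLM : L ≤ M) : FarApart G L a b :=
  fun p => hLM.trans_lt (h p)

theorem FarApart.of_adj {V : Type*} {G : SimpleGraph V} {L : ℕ} {a b c : V}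
    (hL : 0 < L) (h : FarApart G L a b) (hcb : G.Adj c b) : FarApart G (L - 1) a c := fun p => by
  have := h (p.concat hcb)
  rw [SimpleGraph.Walk.length_concat] at this
  omega

/-- `y` is an admissible pair of chord ends for the vertex `n`. -/
def GoodChords (N L n : ℕ) (f : ℕ → ℕ × ℕ) (y : ℕ × ℕ) : Prop :=
  N ≤ n → y.1 < n ∧ y.2 + 1 < n ∧
    (∀ m, N ≤ m → m < n → (f m).1 ≠ y.1 ∧ (f m).2 ≠ y.2) ∧
    FarApart (chordGraph N f n) L (n - 1) y.1 ∧
    FarApart (chordGraph N f n) L (n - 1) y.2 ∧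
    FarApart (chordGraph N f n) L y.1 y.2

theorem chordGraph_congr {N n : ℕ} {f g : ℕ → ℕ × ℕ} (h : ∀ m < n, f m = g m) :
    chordGraph N f n = chordGraph N g n := by
  unfold chordGraph
  congr 1
  ext x y
  refine and_congr_right fun hx => ?_
  rw [h x hx]

theorem GoodChords.congr {N L n : ℕ} {f g : ℕ → ℕ × ℕ} {y : ℕ × ℕ} (h : ∀ m < n, f m = g m)
    (hf : GoodChords N L n f y) : GoodChords N L n g y := by
  intro hn
  obtain ⟨h1, h2, h3, h4⟩ := hf hn
  rw [chordGraph_congr h] at h4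
  refine ⟨h1, h2, fun m hm hmn => ?_, h4⟩
  rw [← h m hmn]
  exact h3 m hm hmn

theorem card_filter_le_one_of_injective {s : Finset ℕ} {g : ℕ → ℕ}
    (hg : ∀ x ∈ s, ∀ y ∈ s, x < y → g x ≠ g y) (v : ℕ) :
    (s.filter fun x => g x = v).card ≤ 1 := by
  rw [Finset.card_le_one]
  intro a ha b hb
  simp only [Finset.mem_filter] at ha hb
  rcases lt_trichotomy a b with h | h | h
  · exact absurd (ha.2.trans hb.2.symm) (hg a ha.1 b hb.1 h)
  · exact h
  · exact absurd (hb.2.trans ha.2.symm) (hg b hb.1 a ha.1 h)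

theorem exists_finset_ball_chordGraph {N n : ℕ} {f : ℕ → ℕ × ℕ}
    (h1 : ∀ x ∈ Finset.Ico N n, ∀ y ∈ Finset.Ico N n, x < y → (f x).1 ≠ (f y).1)
    (h2 : ∀ x ∈ Finset.Ico N n, ∀ y ∈ Finset.Ico N n, x < y → (f x).2 ≠ (f y).2)
    (L v : ℕ) :
    ∃ S : Finset ℕ, S.card ≤ 9 ^ L ∧
      ∀ w, w ∉ S → FarApart (chordGraph N f n) L v w := by
  have h3 : ∀ x ∈ Finset.Ico N n, ∀ y ∈ Finset.Ico N n, x < y →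
      (f x).2 + 1 ≠ (f y).2 + 1 := fun x hx y hy hxy h => h2 x hx y hy hxy (by omega)
  obtain ⟨S, hS, hball⟩ := exists_finset_ball (chordGraph N f n) 8
    (fun v => ({v - 1, v + 1, (f v).1, (f v).2, (f v).2 + 1} : Finset ℕ) ∪
      ((Finset.Ico N n).filter fun x => (f x).1 = v) ∪
      ((Finset.Ico N n).filter fun x => (f x).2 = v) ∪
      ((Finset.Ico N n).filter fun x => (f x).2 + 1 = v))
    (by
      intro v w hvw
      simp only [chordGraph, SimpleGraph.fromRel_adj] at hvw
      simp only [Finset.mem_union, Finset.mem_filter, Finset.mem_Ico, Finset.mem_insert,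
        Finset.mem_singleton]
      omega)
    (by
      intro v
      have c1 := card_filter_le_one_of_injective h1 v
      have c2 := card_filter_le_one_of_injective h2 v
      have c3 := card_filter_le_one_of_injective h3 v
      have c0 : ({v - 1, v + 1, (f v).1, (f v).2, (f v).2 + 1} : Finset ℕ).card ≤ 5 :=
        Finset.card_le_five
      refine (Finset.card_union_le _ _).trans ?_
      have := Finset.card_union_le (({v - 1, v + 1, (f v).1, (f v).2, (f v).2 + 1} : Finset ℕ) ∪
        ((Finset.Ico N n).filter fun x => (f x).1 = v))
        ((Finset.Ico N n).filter fun x => (f x).2 = v)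
      have := Finset.card_union_le ({v - 1, v + 1, (f v).1, (f v).2, (f v).2 + 1} : Finset ℕ)
        ((Finset.Ico N n).filter fun x => (f x).1 = v)
      omega)
    L v
  refine ⟨S, hS, fun w hw p => ?_⟩
  by_contra hp
  exact hw (hball w p (by omega))

theorem exists_lt_notMem {n : ℕ} {S : Finset ℕ} (h : S.card < n) : ∃ y < n, y ∉ S := by
  obtain ⟨y, hy, hyS⟩ := Finset.exists_mem_notMem_of_card_lt_card
    (s := S) (t := Finset.range n) (by simpa using h)
  exact ⟨y, by simpa using hy, hyS⟩

theorem exists_goodChords {N L : ℕ} (hN : 2 * 9 ^ L + 2 ≤ N) (n : ℕ) (f : ℕ → ℕ × ℕ)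
    (hf : ∀ m < n, GoodChords N L m f (f m)) : ∃ y, GoodChords N L n f y := by
  by_cases hn : N ≤ n
  swap
  · exact ⟨default, fun h => absurd h hn⟩
  have h1 : ∀ x ∈ Finset.Ico N n, ∀ y ∈ Finset.Ico N n, x < y →
      (f x).1 ≠ (f y).1 ∧ (f x).2 ≠ (f y).2 := by
    intro x hx y hy hxy
    rw [Finset.mem_Ico] at hx hy
    exact (hf y hy.2 hy.1).2.2.1 x hx.1 hxy
  have ball := exists_finset_ball_chordGraph (fun x hx y hy hxy => (h1 x hx y hy hxy).1)
    (fun x hx y hy hxy => (h1 x hx y hy hxy).2) L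
  obtain ⟨S, hS, hSfar⟩ := ball (n - 1)
  have hused (g : ℕ → ℕ) : ((Finset.Ico N n).image g).card ≤ n - N := by
    simpa using Finset.card_image_le (s := Finset.Ico N n) (f := g)
  obtain ⟨a, han, ha⟩ : ∃ a < n, a ∉ (Finset.Ico N n).image (fun x => (f x).1) ∪ S := by
    apply exists_lt_notMem
    have := Finset.card_union_le ((Finset.Ico N n).image (fun x => (f x).1)) S
    have := hused fun x => (f x).1
    omega
  obtain ⟨T, hT, hTfar⟩ := ball a
  obtain ⟨b, hbn, hb⟩ :
      ∃ b < n - 1, b ∉ ((Finset.Ico N n).image (fun x => (f x).2) ∪ S) ∪ T := by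
    apply exists_lt_notMem
    have := Finset.card_union_le ((Finset.Ico N n).image (fun x => (f x).2) ∪ S) T
    have := Finset.card_union_le ((Finset.Ico N n).image (fun x => (f x).2)) S
    have := hused fun x => (f x).2
    omega
  simp only [Finset.mem_union, not_or, Finset.mem_image, Finset.mem_Ico, not_exists,
    not_and] at ha hb
  exact ⟨(a, b), fun _ => ⟨han, by dsimp only; omega,
    fun m hm hmn => ⟨ha.1 m ⟨hm, hmn⟩, hb.1.1 m ⟨hm, hmn⟩⟩,
    hSfar _ ha.2, hSfar _ hb.1.2, hTfar _ hb.2⟩⟩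

theorem down_of_codeGraph_adj {N L : ℕ} {f : ℕ → ℕ × ℕ} (hf : ∀ n, GoodChords N L n f (f n))
    {α : ℕ → Bool} {n a : ℕ} (h : (codeGraph N f α).Adj n a) (ha : a < n) :
    a + 1 = n ∨ N ≤ n ∧ (a = (f n).1 ∨ a = (f n).2 + (α (n - N)).toNat) := by
  rw [codeGraph, SimpleGraph.fromRel_adj] at h
  rcases h.2 with h | h | ⟨hN, h⟩
  · exact h
  · omega
  · obtain ⟨h1, h2, -⟩ := hf a hN
    have := (α (a - N)).toNat_le
    omega

theorem chordGraph_adj_of_codeGraph_adj {N n : ℕ} {f : ℕ → ℕ × ℕ} {α : ℕ → Bool} {x y : ℕ}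
    (hx : x < n) (hy : y < n) (h : (codeGraph N f α).Adj x y) : (chordGraph N f n).Adj x y := by
  rw [codeGraph, SimpleGraph.fromRel_adj] at h
  rw [chordGraph, SimpleGraph.fromRel_adj]
  have := (α (x - N)).toNat_le
  have := (α (y - N)).toNat_le
  omega

theorem farApart_of_down {N L n : ℕ} (hL : 0 < L) {f : ℕ → ℕ × ℕ} (hf : ∀ n, GoodChords N L n f (f n))
    {α : ℕ → Bool} {a b : ℕ} (hab : a ≠ b)
    (ha : a + 1 = n ∨ N ≤ n ∧ (a = (f n).1 ∨ a = (f n).2 + (α (n - N)).toNat))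
    (hb : b + 1 = n ∨ N ≤ n ∧ (b = (f n).1 ∨ b = (f n).2 + (α (n - N)).toNat)) :
    FarApart (chordGraph N f n) (L - 1) a b := by
  have hn : N ≤ n := by omega
  obtain ⟨-, h2, -, h4, h5, h6⟩ := hf n hn
  have hshift {x : ℕ} (h : FarApart (chordGraph N f n) L x (f n).2) :
      FarApart (chordGraph N f n) (L - 1) x ((f n).2 + (α (n - N)).toNat) := by
    cases α (n - N)
    · exact h.mono (by omega)
    · refine FarApart.of_adj hL h ?_
      rw [chordGraph, SimpleGraph.fromRel_adj]
      exact ⟨by simp, Or.inl ⟨h2, by omega, Or.inl rfl⟩⟩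
  have h4' := h4.mono (Nat.sub_le _ 1)
  have h5' := hshift h5
  have h6' := hshift h6
  have hpred {x : ℕ} (h : x + 1 = n) : x = n - 1 := by omega
  rcases ha with ha | ⟨-, rfl | rfl⟩ <;> rcases hb with hb | ⟨-, rfl | rfl⟩
  · omega
  · rwa [hpred ha]
  · rwa [hpred ha]
  · rw [hpred hb]
    exact h4'.symm
  · omega
  · exact h6'
  · rw [hpred hb]
    exact h5'.symm
  · exact h6'.symm
  · omega

theorem noShortCycles_codeGraph {N k : ℕ} {f : ℕ → ℕ × ℕ}
    (hf : ∀ n, GoodChords N (2 * k) n f (f n)) (α : ℕ → Bool) :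
    NoShortCycles k (codeGraph N f α) := by
  intro v₀ c₀ hc₀
  obtain ⟨n, hn, hmax⟩ := c₀.support.toFinset.exists_max_image id ⟨v₀, by simp⟩
  simp only [List.mem_toFinset, id] at hn hmax
  let c := c₀.rotate n hn
  have hc : c.IsCycle := hc₀.rotate hn
  have hlen : c.length = c₀.length := by simp [c]
  have hle : ∀ x ∈ c.support, x ≤ n := fun x hx =>
    hmax x (by simpa [c] using hx)
  rw [← hlen]
  clear_value c
  by_contra! hshort
  have hnil := hc.not_nil
  have htail : ¬ c.tail.Nil := by
    rw [SimpleGraph.Walk.not_nil_iff_lt_length]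
    grind [hc.three_le_length, SimpleGraph.Walk.length_tail_add_one]
  let p := c.tail.dropLast
  have hplen : p.length + 2 = c.length := by
    have : p.length + 1 = c.tail.length := SimpleGraph.Walk.length_dropLast_add_one htail
    have := SimpleGraph.Walk.length_tail_add_one hnil
    omega
  have hplt : ∀ x ∈ p.support, x < n := by
    intro x hx
    have hnodup := hc.isPath_tail.support_nodup
    have hsupp := SimpleGraph.Walk.support_dropLast_concat htail
    rw [← hsupp] at hnodup
    refine lt_of_le_of_ne (hle x ?_) fun hxn =>
      List.disjoint_of_nodup_append hnodup hx (by simp [hxn])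
    apply List.mem_of_mem_tail
    rw [← c.support_tail_of_not_nil hnil, ← hsupp]
    exact List.mem_append_left _ hx
  have hsnd := c.adj_snd hnil
  have hpen := (c.tail.adj_penultimate htail).symm
  have hne : c.snd ≠ c.tail.penultimate := by
    intro heq
    have hpath : p.IsPath := hc.isPath_tail.dropLast
    have hp0 : p.length = 0 := SimpleGraph.Walk.length_eq_zero_iff.mpr (hpath.nil_iff_eq.mpr heq)
    have := hc.three_le_length
    omega
  have ha := down_of_codeGraph_adj hf hsnd (hplt _ p.start_mem_support)
  have hb := down_of_codeGraph_adj hf hpen (hplt _ p.end_mem_support)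
  let q := p.transfer (chordGraph N f n) (by
    intro e
    induction e with
    | _ x y =>
      intro he
      exact chordGraph_adj_of_codeGraph_adj (hplt _ (p.fst_mem_support_of_mem_edges he))
        (hplt _ (p.snd_mem_support_of_mem_edges he)) (p.adj_of_mem_edges he))
  have hq : q.length = p.length := p.length_transfer _
  have hab := farApart_of_down (by omega) hf hne ha hb
  have := hab q
  omega

theorem NoShortCycles.not_triangle {k : ℕ} (hk : 2 ≤ k) {V : Type*} {G : SimpleGraph V}
    (hG : NoShortCycles k G) {a b c : V} (hab : G.Adj a b) (hbc : G.Adj b c)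
    (hca : G.Adj c a) : False := by
  have h := hG a (.cons hab (.cons hbc (.cons hca .nil))) (by
    have := hab.ne
    have := hbc.ne
    have := hca.ne
    simp [SimpleGraph.Walk.isCycle_def, SimpleGraph.Walk.isTrail_def]
    grind)
  simp at h
  omega

theorem NoShortCycles.eq_of_adj_of_adj {k : ℕ} (hk : 2 ≤ k) {V : Type*} {G : SimpleGraph V}
    (hG : NoShortCycles k G) {a b x y : V} (hab : a ≠ b) (hxa : G.Adj x a) (hxb : G.Adj x b)
    (hya : G.Adj y a) (hyb : G.Adj y b) : x = y := by
  by_contra hxy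
  have h := hG a (.cons hxa.symm (.cons hxb (.cons hyb.symm (.cons hya .nil)))) (by
    have := hxa.ne
    have := hxb.ne
    have := hya.ne
    have := hyb.ne
    simp [SimpleGraph.Walk.isCycle_def, SimpleGraph.Walk.isTrail_def]
    grind)
  simp at h
  omega

/-- Embeddings of two coded graphs which agree on the first `N` vertices agree everywhere, and
    the codes coincide. -/
theorem code_eq_of_embeddings_agree {k N : ℕ} (hk : 2 ≤ k) (hN : 2 ≤ N) {f : ℕ → ℕ × ℕ}
    (hf : ∀ n, GoodChords N (2 * k) n f (f n)) {W : Type*} {G : SimpleGraph W}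
    (hG : NoShortCycles k G) {α β : ℕ → Bool} (φ : codeGraph N f α →g G)
    (ψ : codeGraph N f β →g G) (hφ : Function.Injective φ) (h : ∀ i < N, φ i = ψ i) :
    α = β := by
  have adj (γ : ℕ → Bool) {x y : ℕ} (hxy : x ≠ y)
      (h : y + 1 = x ∨ N ≤ x ∧ (y = (f x).1 ∨ y = (f x).2 + (γ (x - N)).toNat)) :
      (codeGraph N f γ).Adj x y := by
    rw [codeGraph, SimpleGraph.fromRel_adj]
    exact ⟨hxy, Or.inl h⟩
  have hagree : ∀ n, φ n = ψ n := by
    intro n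
    induction n using Nat.strong_induction_on with
    | _ n ih =>
      by_cases hn : n < N
      · exact h n hn
      obtain ⟨h1, -, -, hfar, -⟩ := hf n (by omega)
      have key (γ : ℕ → Bool) (χ : codeGraph N f γ →g G) :
          G.Adj (χ n) (χ (n - 1)) ∧ G.Adj (χ n) (χ (f n).1) :=
        ⟨χ.map_adj (adj γ (by omega) (Or.inl (by omega))),
          χ.map_adj (adj γ h1.ne' (Or.inr ⟨by omega, Or.inl rfl⟩))⟩
      have hψ := key β ψ
      rw [← ih (n - 1) (by omega), ← ih _ h1] at hψ
      exact hG.eq_of_adj_of_adj hk (hφ.ne hfar.ne) (key α φ).1 (key α φ).2 hψ.1 hψ.2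
  funext i
  by_contra hne
  obtain ⟨h1, h2, -⟩ := hf (i + N) (by omega)
  have key (γ : ℕ → Bool) (χ : codeGraph N f γ →g G) :
      G.Adj (χ (i + N)) (χ ((f (i + N)).2 + (γ i).toNat)) := by
    refine χ.map_adj (adj γ ?_ (Or.inr ⟨by omega, Or.inr (by simp)⟩))
    have := (γ i).toNat_le
    omega
  have hedge : G.Adj (φ ((f (i + N)).2 + 1)) (φ (f (i + N)).2) :=
    φ.map_adj (adj α (by omega) (Or.inl rfl))
  have hα := key α φ
  have hβ := key β ψ
  simp only [← hagree] at hβ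
  cases hai : α i <;> cases hbi : β i <;> simp_all only [Bool.toNat_false, Bool.toNat_true,
    add_zero, not_true_eq_false]
  · exact hG.not_triangle hk hβ hedge hα.symm
  · exact hG.not_triangle hk hα hedge hβ.symm

/-- For every `k ≥ 2` there is no universal countable graph in the class of countable
    graphs omitting all cycles of length at most `2k`. -/
theorem no_universal_graph_without_short_cycles (k : ℕ) (hk : 2 ≤ k) :
    ¬ ∃ (W : Type) (G : SimpleGraph W), Countable W ∧ NoShortCycles k G ∧
        ∀ (V : Type) (H : SimpleGraph V), Countable V → NoShortCycles k H →
          IsSubgraphOf H G := by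
  rintro ⟨W, G, hW, hG, huniv⟩
  let N := 2 * 9 ^ (2 * k) + 2
  obtain ⟨f, hf⟩ := exists_greedy_sequence (GoodChords N (2 * k))
    (fun n f g y h => GoodChords.congr h) (exists_goodChords le_rfl)
  choose φ hφ using fun α : ℕ → Bool =>
    huniv ℕ (codeGraph N f α) inferInstance (noShortCycles_codeGraph hf α)
  have hinj : Function.Injective fun (α : ℕ → Bool) (i : Fin N) => φ α i := by
    intro α β h
    exact code_eq_of_embeddings_agree hk (by omega) hf hG (φ α) (φ β) (hφ α)
      fun i hi => congrFun h ⟨i, hi⟩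
  have hcount : Countable (ℕ → Bool) := hinj.countable
  obtain ⟨g, hg⟩ := exists_surjective_nat (ℕ → Bool)
  obtain ⟨n, hn⟩ := hg fun n => !g n n
  simpa using congrFun hn n
end

section
/- For every n ≥ 1, if a drive through T is a subgraph of a B_n-free graph G, then deg_T(v) = deg_G(v) for every vertex v of T except possibly the left exit l and the right exit r. -/
open SimpleGraph

/-- Vertex set of a drive through: the vertices of `K_{n+2}`, then for each of the `n`
    middle vertices a copy of a dead end minus its top vertex `p_{n+1}` (which is
    identified with the corresponding vertex of `K_{n+2}`), and two exits
    (`Sum.inr (Sum.inr 0) = l`, the left exit, and `Sum.inr (Sum.inr 1) = r`, the right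
    exit). In the dead-end copies, `0,…,n+2` are `k₁,…,k_{n+3} = p₀` and
    `n+3,…,2n+2` are `p₁,…,pₙ`. -/
abbrev DTV (n : ℕ) := Fin (n + 2) ⊕ (Fin n × Fin (2 * n + 3)) ⊕ Fin 2

/-- The drive through graph `T` (for parameter `n`): a complete graph `K_{n+2}` on
    `k₁,…,k_{n+2}`, with a disjoint copy of a dead end freely adjoined to each `kᵢ`
    for `1 < i < n+2` by identifying its `p_{n+1}` with `kᵢ`, a left exit `l` joined
    to `k₁` and a right exit `r` joined to `k_{n+2}`. -/
def DriveThrough (n : ℕ) : SimpleGraph (DTV n) :=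
  SimpleGraph.fromRel (fun a b =>
    match a, b with
    | .inl u, .inl v => u ≠ v
    | .inr (.inl (i, x)), .inr (.inl (i', y)) => i = i' ∧
        (((x : ℕ) < n + 3 ∧ (y : ℕ) < n + 3 ∧ x ≠ y) ∨
         (n + 2 ≤ (x : ℕ) ∧ (x : ℕ) < 2 * n + 2 ∧ (y : ℕ) = (x : ℕ) + 1))
    | .inr (.inl (i, x)), .inl j => (x : ℕ) = 2 * n + 2 ∧ (j : ℕ) = (i : ℕ) + 1
    | .inr (.inr t), .inl j => ((t : ℕ) = 0 ∧ (j : ℕ) = 0) ∨ ((t : ℕ) = 1 ∧ (j : ℕ) = n + 1)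
    | _, _ => False)

/-- A path with vertex list `P` on `n + 1` vertices, with two extra neighbours at each end. -/
theorem bridge_isSubgraphOf_s7 {V : Type*} {G : SimpleGraph V} {n : ℕ} {P : List V}
    {a b d e : V} (hlen : P.length = n + 1) (hchain : P.IsChain G.Adj)
    (hnodup : (a :: b :: (P ++ [d, e])).Nodup)
    (ha : ∀ c ∈ P.head?, G.Adj a c ∧ G.Adj b c)
    (hd : ∀ u ∈ P.getLast?, G.Adj u d ∧ G.Adj u e) : IsSubgraphOf (Bridge n) G := by
  set L := a :: b :: (P ++ [d, e]) with hL
  have hLl : L.length = n + 5 := by simp [hL, hlen]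
  have hP : ∀ i (hi : i < n + 1), L[i + 2]'(by omega) = P[i]'(by omega) := by
    intro i hi
    simp [hL, hlen, hi]
  have hrel : ∀ u v : Fin (n + 5), (((u : ℕ) = 0 ∧ (v : ℕ) = 2) ∨ ((u : ℕ) = 1 ∧ (v : ℕ) = 2) ∨
      (2 ≤ (u : ℕ) ∧ (u : ℕ) < n + 2 ∧ (v : ℕ) = (u : ℕ) + 1) ∨
      ((u : ℕ) = n + 2 ∧ (v : ℕ) = n + 3) ∨ ((u : ℕ) = n + 2 ∧ (v : ℕ) = n + 4)) →
      G.Adj (L[(u : ℕ)]'(by omega)) (L[(v : ℕ)]'(by omega)) := by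
    have hhead := ha P[0] (by simp [List.head?_eq_getElem?])
    have hlast := hd P[n] (by simp [List.getLast?_eq_getElem?, hlen])
    rintro ⟨u, hu⟩ ⟨v, hv⟩ h
    dsimp only at h ⊢
    rcases h with ⟨rfl, rfl⟩ | ⟨rfl, rfl⟩ | ⟨h1, h2, rfl⟩ | ⟨rfl, rfl⟩ | ⟨rfl, rfl⟩
    · rw [hP 0 (by omega)]
      exact hhead.1
    · rw [hP 0 (by omega)]
      exact hhead.2
    · obtain ⟨k, rfl⟩ := Nat.exists_eq_add_of_le' h1
      have h3 := List.isChain_iff_getElem.1 hchain k (by omega)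
      rw [hP k (by omega)]
      simpa [← hP (k + 1) (by omega), Nat.add_right_comm] using h3
    · rw [hP n (by omega)]
      simpa [hL, List.getElem_append, hlen] using hlast.1
    · rw [hP n (by omega)]
      simpa [hL, List.getElem_append, hlen] using hlast.2
  refine ⟨⟨fun u => L[(u : ℕ)]'(by omega), ?_⟩, ?_⟩
  · intro u v huv
    rw [Bridge, SimpleGraph.fromRel_adj] at huv
    rcases huv.2 with h | h
    · exact hrel u v h
    · exact (hrel v u h).symm
  · intro u v huv
    exact Fin.ext ((hnodup.getElem_inj_iff).1 huv)

theorem SimpleGraph.IsClique.isChain_of_nodup {V : Type*} {G : SimpleGraph V} {s : Set V}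
    (hs : G.IsClique s) {L : List V} (hL : L.Nodup) (hLs : ∀ x ∈ L, x ∈ s) :
    L.IsChain G.Adj :=
  (List.Pairwise.imp_of_mem (fun hx hy hne => hs (hLs _ hx) (hLs _ hy) hne) hL).isChain

/-- A clique on `n + 1` vertices, two of which have two extra neighbours each. -/
theorem bridge_isSubgraphOf_of_clique {V : Type*} {G : SimpleGraph V} {n : ℕ}
    {D : Finset V} (hD : G.IsClique (D : Set V)) (hcard : D.card = n + 1) {c u : V}
    (hc : c ∈ D) (hu : u ∈ D) (hcu : c ≠ u) {a b d e : V} (hnodup : [a, b, d, e].Nodup)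
    (ha : a ∉ D) (hb : b ∉ D) (hd : d ∉ D) (he : e ∉ D) (hac : G.Adj c a) (hbc : G.Adj c b)
    (hud : G.Adj u d) (hue : G.Adj u e) : IsSubgraphOf (Bridge n) G := by
  classical
  have hcard' : ((D.erase c).erase u).card + 2 = n + 1 := by
    have h1 := Finset.card_erase_add_one hc
    have h2 := Finset.card_erase_add_one (Finset.mem_erase.2 ⟨hcu.symm, hu⟩)
    omega
  set M := ((D.erase c).erase u).toList with hM
  have hmem : ∀ x ∈ c :: (M ++ [u]), x ∈ D := by
    intro x hx
    simp only [hM, List.mem_cons, List.mem_append, Finset.mem_toList, Finset.mem_erase,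
      List.not_mem_nil, or_false] at hx
    rcases hx with rfl | hx | rfl
    exacts [hc, hx.2.2, hu]
  have hnd : (c :: (M ++ [u])).Nodup := by
    simp [List.nodup_append, hM, Finset.nodup_toList, hcu]
    grind
  refine bridge_isSubgraphOf_s7 (P := c :: (M ++ [u])) (a := a) (b := b) (d := d) (e := e) ?_
    (hD.isChain_of_nodup hnd hmem) ?_ ?_ ?_
  · simp only [hM, List.length_cons, List.length_append, Finset.length_toList, List.length_nil]
    omega
  · generalize c :: (M ++ [u]) = P at hmem hnd
    simp only [List.nodup_cons, List.nodup_append, List.mem_append]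
    simp at hnodup
    grind
  · simp [hac.symm, hbc.symm]
  · rw [← List.cons_append, List.getLast?_concat]
    rintro _ ⟨⟩
    exact ⟨hud, hue⟩

/-- A path `Q` ending in a large clique `C` and otherwise disjoint from it, with two extra
neighbours at its first vertex. -/
theorem bridge_isSubgraphOf_of_path_to_clique {V : Type*} {G : SimpleGraph V} {n : ℕ}
    {C : Finset V} (hC : G.IsClique (C : Set V)) {Q : List V} {t : V} (ht : t ∈ C)
    (hQC : ∀ x ∈ Q, x ∉ C) (hQl : Q.length ≤ n) (hcard : n + 3 ≤ C.card + Q.length)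
    (hQnd : Q.Nodup) (hQ : (Q ++ [t]).IsChain G.Adj)
    {a b : V} (hab : a ≠ b) (ha : a ∉ Q) (hb : b ∉ Q) (haC : a ∉ C) (hbC : b ∉ C)
    (hadj : ∀ c ∈ (Q ++ [t]).head?, G.Adj a c ∧ G.Adj b c) : IsSubgraphOf (Bridge n) G := by
  classical
  have hCt := Finset.card_erase_add_one ht
  obtain ⟨E, hE, hEc⟩ := Finset.exists_subset_card_eq (s := C.erase t) (n := n - Q.length)
    (by omega)
  have hrest : 1 < (C.erase t \ E).card := by
    rw [Finset.card_sdiff_of_subset hE]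
    omega
  obtain ⟨d, hd, e, he, hde⟩ := Finset.one_lt_card.1 hrest
  simp only [Finset.mem_sdiff, Finset.mem_erase] at hd he
  have hmem : ∀ x ∈ t :: E.toList, x ∈ C := by
    intro x hx
    simp only [List.mem_cons, Finset.mem_toList] at hx
    rcases hx with rfl | hx
    exacts [ht, Finset.mem_of_mem_erase (hE hx)]
  have hnd : (t :: E.toList).Nodup := by
    simp only [List.nodup_cons, Finset.mem_toList, Finset.nodup_toList, and_true]
    exact fun h => Finset.notMem_erase t C (hE h)
  have hdE : d ∉ t :: E.toList := by simpa using ⟨hd.1.1, hd.2⟩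
  have heE : e ∉ t :: E.toList := by simpa using ⟨he.1.1, he.2⟩
  refine bridge_isSubgraphOf_s7 (P := Q ++ t :: E.toList) (a := a) (b := b) (d := d) (e := e) ?_ ?_
    ?_ ?_ ?_
  · simp only [List.length_append, List.length_cons, Finset.length_toList]
    omega
  · rw [List.isChain_split]
    exact ⟨hQ, hC.isChain_of_nodup hnd hmem⟩
  · generalize t :: E.toList = R at hmem hnd hdE heE
    simp only [List.nodup_cons, List.nodup_append, List.mem_append, List.mem_cons,
      List.not_mem_nil]
    grind
  · intro c hc
    apply hadj
    cases Q <;> simpa using hc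
  · intro u hu
    have hu' : u ∈ t :: E.toList := by
      rw [List.getLast?_append_of_ne_nil _ (by simp)] at hu
      exact List.mem_of_mem_getLast? hu
    exact ⟨hC (hmem u hu') hd.1.2 (fun h => hdE (h ▸ hu')),
      hC (hmem u hu') he.1.2 (fun h => heE (h ▸ hu'))⟩

/-- The only edges leaving a clique on `n + 2` vertices that carries a matching to outside
vertices are those of the matching. -/
theorem mem_or_eq_of_adj_of_clique_matching {V : Type*} {G : SimpleGraph V} {n : ℕ}
    (hn : 1 ≤ n) (hG : GraphFree (Bridge n) G) {C : Finset V} (hC : G.IsClique (C : Set V))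
    (hcard : C.card = n + 2) {q : V → V} (hq : Set.InjOn q C) (hqC : ∀ x ∈ C, q x ∉ C)
    (hadj : ∀ x ∈ C, G.Adj x (q x)) {v w : V} (hv : v ∈ C) (hvw : G.Adj v w) :
    w ∈ C ∨ w = q v := by
  classical
  by_contra! hw
  have hCv := Finset.card_erase_add_one hv
  obtain ⟨u₁, hu₁, u₂, hu₂, hu₁₂⟩ := Finset.one_lt_card.1 (show 1 < (C.erase v).card by omega)
  rw [Finset.mem_erase] at hu₁ hu₂
  have main : ∀ u z, u ∈ C → z ∈ C → u ≠ v → z ≠ v → u ≠ z → q u ≠ w → False := by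
    intro u z hu hz huv hzv huz hqu
    have hqu' : q u ≠ q v := fun h => huv (hq hu hv h)
    refine hG (bridge_isSubgraphOf_of_clique (D := C.erase z) (hC.subset (by simp)) ?_
      (c := v) (u := u) (a := w) (b := q v) (d := z) (e := q u) ?_ ?_ huv.symm ?_ ?_ ?_ ?_ ?_
      hvw (hadj v hv) (hC hu hz huz) (hadj u hu))
    · have := Finset.card_erase_add_one hz
      omega
    all_goals grind
  by_cases h : q u₁ = w
  · exact main u₂ u₁ hu₂.2 hu₁.2 hu₂.1 hu₁.1 hu₁₂.symm
      (fun h' => hu₁₂ (hq hu₁.2 hu₂.2 (h.trans h'.symm)))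
  · exact main u₁ u₂ hu₁.2 hu₂.2 hu₁.1 hu₂.1 hu₁₂ h

/-- The only edge leaving the clique of a dead end is the first edge of its path. -/
theorem mem_or_eq_of_adj_deadEnd_clique {V : Type*} {G : SimpleGraph V} {n : ℕ}
    (hn : 1 ≤ n) (hG : GraphFree (Bridge n) G) {C : Finset V} (hC : G.IsClique (C : Set V))
    (hcard : C.card = n + 3) {p₀ p₁ p₂ : V} (h₀ : p₀ ∈ C) (h₁ : p₁ ∉ C) (h₂ : p₂ ∉ C)
    (h₀₁ : G.Adj p₀ p₁) (h₁₂ : G.Adj p₁ p₂) {v w : V} (hv : v ∈ C) (hvw : G.Adj v w) :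
    w ∈ C ∨ v = p₀ ∧ w = p₁ := by
  classical
  by_contra! ⟨hw, hvw'⟩
  by_cases hv₀ : v = p₀
  · subst hv₀
    refine hG (bridge_isSubgraphOf_of_path_to_clique hC (Q := []) (t := v) (a := w) (b := p₁)
      hv ?_ ?_ ?_ ?_ ?_ (hvw' rfl) ?_ ?_ hw h₁ ?_)
    all_goals simp [hcard, hvw.symm, h₀₁.symm]
  by_cases hw₁ : w = p₁
  · subst hw₁
    have := Finset.card_erase_add_one h₀
    refine hG (bridge_isSubgraphOf_of_path_to_clique (C := C.erase p₀) (hC.subset (by simp))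
      (Q := [w]) (t := v) (a := p₀) (b := p₂)
      (by simp [hv, hv₀]) (by simp [hw]) ?_ ?_ ?_ ?_ ?_ ?_ ?_ ?_ ?_ ?_)
    all_goals simp [hn, hvw.symm, h₀₁, h₁₂.symm, h₀₁.ne, h₁₂.ne', h₂]
    · omega
    · grind
  · have h1 := Finset.card_erase_add_one hv
    have h2 := Finset.card_erase_add_one (Finset.mem_erase.2 ⟨Ne.symm hv₀, h₀⟩)
    obtain ⟨z₁, hz₁, z₂, hz₂, hz⟩ :=
      Finset.one_lt_card.1 (show 1 < ((C.erase v).erase p₀).card by omega)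
    simp only [Finset.mem_erase] at hz₁ hz₂
    refine hG (bridge_isSubgraphOf_of_clique (D := (C.erase z₁).erase z₂) (hC.subset ?_) ?_
      (c := v) (u := p₀) (a := w) (b := z₁) (d := z₂) (e := p₁) ?_ ?_ hv₀ ?_ ?_ ?_ ?_ ?_
      hvw (hC hv hz₁.2.2 (Ne.symm hz₁.2.1)) (hC h₀ hz₂.2.2 (Ne.symm hz₂.1)) h₀₁)
    · intro x hx
      simp_all
    · have h1 := Finset.card_erase_add_one hz₁.2.2
      have h2 := Finset.card_erase_add_one (Finset.mem_erase.2 ⟨hz.symm, hz₂.2.2⟩)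
      omega
    all_goals grind

/-- The inner vertices of the path of a dead end have no neighbours off the path. -/
theorem eq_or_eq_of_adj_deadEnd_path {V : Type*} {G : SimpleGraph V} {n : ℕ}
    (hG : GraphFree (Bridge n) G) {C : Finset V} (hC : G.IsClique (C : Set V))
    (hcard : C.card = n + 3) {p : ℕ → V} (hp : Set.InjOn p (Set.Iic (n + 1))) (h₀ : p 0 ∈ C)
    (hpC : ∀ m, 1 ≤ m → m ≤ n + 1 → p m ∉ C) (hadj : ∀ m ≤ n, G.Adj (p m) (p (m + 1)))
    {m : ℕ} {w : V} (hm : m + 1 ≤ n) (hw : G.Adj (p (m + 1)) w) :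
    w = p m ∨ w = p (m + 2) := by
  have hpi : ∀ i j, i ≤ n + 1 → j ≤ n + 1 → p i = p j → i = j := fun i j hi hj h => hp hi hj h
  by_contra! ⟨hwm, hwm2⟩
  have hdown : ∀ j ≤ n, (((List.range j).map fun i => p (j - i)) ++ [p 0]).IsChain G.Adj := by
    intro j hj
    have : ((List.range j).map fun i => p (j - i)) ++ [p 0]
        = (List.range (j + 1)).map fun i => p (j - i) := by
      simp [List.range_succ]
    rw [this, List.isChain_iff_getElem]
    intro i hi
    simp only [List.length_map, List.length_range] at hi
    simp only [List.getElem_map, List.getElem_range]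
    have h := hadj (j - (i + 1)) (by omega)
    rw [show j - (i + 1) + 1 = j - i by omega] at h
    exact h.symm
  have hdnd : ∀ j ≤ n, ((List.range j).map fun i => p (j - i)).Nodup := by
    intro j hj
    refine List.Nodup.map_on ?_ List.nodup_range
    intro x hx y hy h
    rw [List.mem_range] at hx hy
    have := hpi _ _ (by omega) (by omega) h
    omega
  by_cases hwC : w ∈ C
  · have := mem_or_eq_of_adj_deadEnd_clique (by omega) hG hC hcard h₀
      (hpC 1 le_rfl (by omega)) (hpC 2 (by omega) (by omega)) (hadj 0 (by omega))
      (hadj 1 (by omega)) hwC hw.symm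
    rcases this with h | ⟨h, h'⟩
    · exact hpC _ (by omega) (by omega) h
    · have := hpi _ _ (by omega) (by omega) h'
      obtain rfl : m = 0 := by omega
      exact hwm h
  by_cases hwp : ∃ j, 1 ≤ j ∧ j ≤ m + 1 ∧ w = p j
  · obtain ⟨j, hj1, hj2, rfl⟩ := hwp
    have hjm : j < m := by
      have h1 : j ≠ m := fun h => hwm (h ▸ rfl)
      have h2 : j ≠ m + 1 := fun h => hw.ne (h ▸ rfl)
      omega
    refine hG (bridge_isSubgraphOf_of_path_to_clique hC
      (Q := p (m + 1) :: (List.range j).map fun i => p (j - i)) (t := p 0) (a := p (m + 2))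
      (b := p m) h₀ ?_ ?_ ?_ ?_ ?_ ?_ ?_ ?_ (hpC _ (by omega) (by omega))
      (hpC _ (by omega) (by omega)) ?_)
    · simp only [List.mem_cons, List.mem_map, List.mem_range]
      rintro x (rfl | ⟨i, hi, rfl⟩) <;> exact hpC _ (by omega) (by omega)
    · simp; omega
    · simp; omega
    · refine List.nodup_cons.2 ⟨?_, hdnd j (by omega)⟩
      simp only [List.mem_map, List.mem_range, not_exists, not_and]
      intro i hi h
      have := hpi _ _ (by omega) (by omega) h
      omega
    · rw [List.cons_append, List.isChain_cons]
      refine ⟨?_, hdown j (by omega)⟩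
      obtain ⟨j, rfl⟩ := Nat.exists_eq_add_of_le' hj1
      simpa [List.range_succ_eq_map] using hw
    · intro h
      have := hpi _ _ (by omega) (by omega) h
      omega
    · simp only [List.mem_cons, List.mem_map, List.mem_range, not_or, not_exists, not_and]
      refine ⟨fun h => ?_, fun i hi h => ?_⟩ <;>
      · have := hpi _ _ (by omega) (by omega) h
        omega
    · simp only [List.mem_cons, List.mem_map, List.mem_range, not_or, not_exists, not_and]
      refine ⟨fun h => ?_, fun i hi h => ?_⟩ <;>
      · have := hpi _ _ (by omega) (by omega) h
        omega
    · simpa using ⟨(hadj (m + 1) (by omega)).symm, hadj m (by omega)⟩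
  · refine hG (bridge_isSubgraphOf_of_path_to_clique hC
      (Q := (List.range (m + 1)).map fun i => p (m + 1 - i)) (t := p 0) (a := p (m + 2))
      (b := w) h₀ ?_ ?_ ?_ (hdnd _ hm) (hdown _ hm) hwm2.symm ?_ ?_ (hpC _ (by omega) (by omega))
      hwC ?_)
    · simp only [List.mem_map, List.mem_range]
      rintro x ⟨i, hi, rfl⟩
      exact hpC _ (by omega) (by omega)
    · simpa using hm
    · simp; omega
    · simp only [List.mem_map, List.mem_range, not_exists, not_and]
      intro i hi h
      have := hpi _ _ (by omega) (by omega) h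
      omega
    · simp only [List.mem_map, List.mem_range, not_exists, not_and]
      exact fun i hi h => hwp ⟨m + 1 - i, by omega, by omega, h.symm⟩
    · simpa [List.range_succ_eq_map] using ⟨(hadj (m + 1) (by omega)).symm, hw.symm⟩

/-- The neighbour of a clique vertex of the drive through outside the clique. -/
def driveThroughExit (n : ℕ) (u : Fin (n + 2)) : DTV n :=
  if h₀ : (u : ℕ) = 0 then .inr (.inr 0)
  else if h : (u : ℕ) ≤ n then
    .inr (.inl (⟨(u : ℕ) - 1, by omega⟩, ⟨2 * n + 2, by omega⟩))
  else .inr (.inr 1)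

theorem driveThroughExit_injective (n : ℕ) : Function.Injective (driveThroughExit n) := by
  intro u v h
  unfold driveThroughExit at h
  ext
  split_ifs at h <;> simp at h <;> omega

theorem driveThroughExit_ne_inl {n : ℕ} (u v : Fin (n + 2)) :
    driveThroughExit n u ≠ .inl v := by
  unfold driveThroughExit
  split_ifs <;> simp

theorem driveThrough_adj_exit {n : ℕ} (u : Fin (n + 2)) :
    (DriveThrough n).Adj (.inl u) (driveThroughExit n u) := by
  unfold driveThroughExit
  split_ifs <;> simp [DriveThrough, -Fin.val_eq_zero_iff] <;> omega

theorem driveThrough_adj_inl {n : ℕ} {u v : Fin (n + 2)} :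
    (DriveThrough n).Adj (.inl u) (.inl v) ↔ u ≠ v := by
  simp [DriveThrough]
  tauto

theorem driveThrough_adj_deadEnd_clique {n : ℕ} {i : Fin n} {x y : Fin (2 * n + 3)}
    (hx : (x : ℕ) < n + 3) (hy : (y : ℕ) < n + 3) (hxy : x ≠ y) :
    (DriveThrough n).Adj (.inr (.inl (i, x))) (.inr (.inl (i, y))) := by
  simp [DriveThrough, hx, hy, hxy]

/-- The path of the dead end with index `i`, from the dead end's clique to the clique of the
drive through. -/
def deadEndPath (n : ℕ) (i : Fin n) (m : ℕ) : DTV n :=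
  if h : m ≤ n then .inr (.inl (i, ⟨n + 2 + m, by omega⟩)) else .inl ⟨(i : ℕ) + 1, by omega⟩

theorem deadEndPath_injOn (n : ℕ) (i : Fin n) :
    Set.InjOn (deadEndPath n i) (Set.Iic (n + 1)) := by
  intro a ha b hb h
  simp only [Set.mem_Iic] at ha hb
  unfold deadEndPath at h
  split_ifs at h <;> simp at h <;> omega

theorem driveThrough_adj_deadEndPath {n : ℕ} (i : Fin n) {m : ℕ} (hm : m ≤ n) :
    (DriveThrough n).Adj (deadEndPath n i m) (deadEndPath n i (m + 1)) := by
  unfold deadEndPath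
  split_ifs <;> simp [DriveThrough] <;> omega

theorem driveThrough_exists_of_adj_inl {n : ℕ} (hn : 1 ≤ n) {V : Type*} {G : SimpleGraph V}
    (f : DriveThrough n →g G) (hf : Function.Injective f) (hG : GraphFree (Bridge n) G)
    (u : Fin (n + 2)) {w : V} (hw : G.Adj (f (.inl u)) w) :
    ∃ v, (DriveThrough n).Adj (.inl u) v ∧ f v = w := by
  classical
  have hk : Function.Injective fun u : Fin (n + 2) => f (.inl u) :=
    hf.comp Sum.inl_injective
  have hext : ∀ u : Fin (n + 2), Function.extend (fun u => f (.inl u))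
      (fun u => f (driveThroughExit n u)) id (f (.inl u)) = f (driveThroughExit n u) :=
    fun u => hk.extend_apply _ _ u
  have key : w ∈ Finset.univ.image (fun u => f (.inl u)) ∨
      w = f (driveThroughExit n u) := by
    rw [← hext u]
    refine mem_or_eq_of_adj_of_clique_matching hn hG
      (C := Finset.univ.image fun u => f (.inl u)) (v := f (.inl u)) (w := w)
      (q := Function.extend (fun u => f (.inl u)) (fun u => f (driveThroughExit n u)) id)
      ?_ ?_ ?_ ?_ ?_ ?_ hw
    · simp only [Finset.coe_image, Finset.coe_univ, Set.image_univ]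
      rintro _ ⟨a, rfl⟩ _ ⟨b, rfl⟩ hab
      exact f.map_adj (driveThrough_adj_inl.2 fun h => hab (h ▸ rfl))
    · rw [Finset.card_image_of_injective _ hk, Finset.card_univ, Fintype.card_fin]
    · simp only [Finset.coe_image, Finset.coe_univ, Set.image_univ]
      rintro _ ⟨a, rfl⟩ _ ⟨b, rfl⟩ hab
      simp only [hext] at hab
      rw [driveThroughExit_injective n (hf hab)]
    · simp only [Finset.mem_image, Finset.mem_univ, true_and]
      rintro _ ⟨a, rfl⟩ ⟨b, hab⟩
      rw [hext] at hab
      exact driveThroughExit_ne_inl a b (hf hab).symm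
    · simp only [Finset.mem_image, Finset.mem_univ, true_and]
      rintro _ ⟨a, rfl⟩
      rw [hext]
      exact f.map_adj (driveThrough_adj_exit a)
    · exact Finset.mem_image_of_mem _ (Finset.mem_univ u)
  rcases key with h | h
  · obtain ⟨v, -, rfl⟩ := Finset.mem_image.1 h
    exact ⟨.inl v, driveThrough_adj_inl.2 fun h => hw.ne (h ▸ rfl), rfl⟩
  · exact ⟨_, driveThrough_adj_exit u, h.symm⟩

theorem driveThrough_exists_of_adj_deadEnd {n : ℕ} (hn : 1 ≤ n) {V : Type*}
    {G : SimpleGraph V} (f : DriveThrough n →g G) (hf : Function.Injective f)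
    (hG : GraphFree (Bridge n) G) (i : Fin n) (x : Fin (2 * n + 3)) {w : V}
    (hw : G.Adj (f (.inr (.inl (i, x)))) w) :
    ∃ v, (DriveThrough n).Adj (.inr (.inl (i, x))) v ∧ f v = w := by
  classical
  set k : Fin (n + 3) → DTV n := fun y => .inr (.inl (i, ⟨y, by omega⟩)) with hk
  have hkinj : Function.Injective fun y => f (k y) :=
    hf.comp fun a b h => by simpa [hk, Fin.ext_iff] using h
  set C := Finset.univ.image fun y => f (k y) with hCdef
  have hC : G.IsClique (C : Set V) := by
    simp only [hCdef, Finset.coe_image, Finset.coe_univ, Set.image_univ]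
    rintro _ ⟨a, rfl⟩ _ ⟨b, rfl⟩ hab
    refine f.map_adj (driveThrough_adj_deadEnd_clique a.2 b.2 fun h => hab ?_)
    have hval := congrArg Fin.val h
    obtain rfl : a = b := Fin.ext hval
    rfl
  have hcard : C.card = n + 3 := by
    rw [Finset.card_image_of_injective _ hkinj, Finset.card_univ, Fintype.card_fin]
  have h₀ : f (deadEndPath n i 0) ∈ C :=
    Finset.mem_image.2 ⟨⟨n + 2, by omega⟩, Finset.mem_univ _, by simp [hk, deadEndPath]⟩
  have hpC : ∀ m, 1 ≤ m → m ≤ n + 1 → f (deadEndPath n i m) ∉ C := by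
    intro m hm hm' h
    obtain ⟨y, -, hy⟩ := Finset.mem_image.1 h
    have := hf hy
    unfold deadEndPath at this
    split_ifs at this
    · simp [hk] at this
      omega
  have hadj : ∀ m ≤ n, G.Adj (f (deadEndPath n i m)) (f (deadEndPath n i (m + 1))) :=
    fun m hm => f.map_adj (driveThrough_adj_deadEndPath i hm)
  rcases Nat.lt_or_ge x (n + 3) with hx | hx
  · rcases mem_or_eq_of_adj_deadEnd_clique hn hG hC hcard h₀ (hpC 1 le_rfl (by omega))
      (hpC 2 (by omega) (by omega)) (hadj 0 (by omega)) (hadj 1 hn)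
      (Finset.mem_image.2 ⟨⟨x, hx⟩, Finset.mem_univ _, rfl⟩) hw with h | ⟨h, h'⟩
    · obtain ⟨y, -, rfl⟩ := Finset.mem_image.1 h
      refine ⟨k y, driveThrough_adj_deadEnd_clique hx y.2 fun h => hw.ne ?_, rfl⟩
      rw [h]
    · have hx' : (.inr (.inl (i, x)) : DTV n) = deadEndPath n i 0 := hf h
      rw [hx']
      exact ⟨_, driveThrough_adj_deadEndPath i (Nat.zero_le n), h'.symm⟩
  · obtain ⟨m, hm⟩ := Nat.exists_eq_add_of_le hx
    have hmn : m + 1 ≤ n := by omega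
    have hx' : (.inr (.inl (i, x)) : DTV n) = deadEndPath n i (m + 1) := by
      simp [deadEndPath, hmn, Fin.ext_iff]
      omega
    rw [hx'] at hw ⊢
    rcases eq_or_eq_of_adj_deadEnd_path hG hC hcard (p := fun m => f (deadEndPath n i m))
      (fun a ha b hb h => deadEndPath_injOn n i ha hb (hf h)) h₀ hpC hadj hmn hw with h | h
    · exact ⟨_, (driveThrough_adj_deadEndPath i (by omega)).symm, h.symm⟩
    · exact ⟨_, driveThrough_adj_deadEndPath i hmn, h.symm⟩

/-- If a drive through is a subgraph of a `B_n`-free graph `G` (witnessed by an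
    injective graph homomorphism `f`), then every vertex of the drive through other
    than the left exit `l` and the right exit `r` has the same degree in the drive
    through as in `G`. -/
theorem driveThrough_degree_eq (n : ℕ) (hn : 1 ≤ n) {V : Type*} (G : SimpleGraph V)
    (f : DriveThrough n →g G) (hf : Function.Injective f)
    (hG : GraphFree (Bridge n) G) (v : DTV n)
    (hl : v ≠ Sum.inr (Sum.inr 0)) (hr : v ≠ Sum.inr (Sum.inr 1)) :
    ((DriveThrough n).neighborSet v).encard = (G.neighborSet (f v)).encard := by
  rw [← (hf.injOn (s := (DriveThrough n).neighborSet v)).encard_image]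
  congr 1
  ext w
  simp only [Set.mem_image, mem_neighborSet]
  constructor
  · rintro ⟨x, hx, rfl⟩
    exact f.map_adj hx
  · intro hw
    rcases v with u | ⟨i, x⟩ | t
    · exact driveThrough_exists_of_adj_inl hn f hf hG u hw
    · exact driveThrough_exists_of_adj_deadEnd hn f hf hG i x hw
    · fin_cases t
      · exact absurd rfl hl
      · exact absurd rfl hr
end
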